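/- Let p ≥ 5 be a prime, let k be a positive integer with p ≥ 2k−2, and let F ∈ ℤ_(p)[Q,R] be isobaric of weight k and not involving P. Then for every integer m with 1 ≤ 2m ≤ k−2, both of the following hold: (1) D^{mp²−p}F lies in (A^p, p)^{2m−1}, i.e. v(D^{mp²−p}F) ≥ 2m−1; and (2) D^{mp²}F lies in (A^p, p)^{2m}, i.e. v(D^{mp²}F) ≥ 2m. -/

import Mathlib

open MvPolynomial Finset

noncomputable section

/-- `x` lies in `ℤ_(p) ⊆ ℚ`: `p` does not divide the reduced denominator of `x`. -/
def pInt (p : ℕ) (x : ℚ) : Prop := ¬ p ∣ x.den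

/-- The polynomial ring `ℚ[P,Q,R]`, with `P = X 0`, `Q = X 1`, `R = X 2`. -/
abbrev Poly3 : Type := MvPolynomial (Fin 3) ℚ

/-- `f` has all of its coefficients in `ℤ_(p)`. -/
def polyPInt (p : ℕ) (f : Poly3) : Prop := ∀ m : Fin 3 →₀ ℕ, pInt p (coeff m f)

/-- `f` is isobaric of weight `w`, where `P, Q, R` have weights `2, 4, 6`. -/
def Isobaric (w : ℕ) (f : Poly3) : Prop :=
  ∀ m ∈ f.support, 2 * m 0 + 4 * m 1 + 6 * m 2 = w

/-- `f` does not involve the variable `P`. -/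
def NoP (f : Poly3) : Prop := ∀ m ∈ f.support, m 0 = 0

/-- The Ramanujan derivation `D` on `ℚ[P,Q,R]`, the unique derivation with
`DP = (P²-Q)/12`, `DQ = (PQ-R)/3`, `DR = (PR-Q²)/2`. -/
def Dop (f : Poly3) : Poly3 :=
  C (1/12 : ℚ) * (X 0 ^ 2 - X 1) * pderiv 0 f
    + C (1/3 : ℚ) * (X 0 * X 1 - X 2) * pderiv 1 f
    + C (1/2 : ℚ) * (X 0 * X 2 - X 1 ^ 2) * pderiv 2 f

/-- The sum of the `j`-th powers of the divisors of `n`, as a rational number. -/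
def sigmaQ (j n : ℕ) : ℚ := ∑ d ∈ n.divisors, (d : ℚ) ^ j

/-- The q-expansion of `E₂`. -/
def E2s : PowerSeries ℚ := PowerSeries.mk fun n => if n = 0 then 1 else -24 * sigmaQ 1 n

/-- The q-expansion of `E₄`. -/
def E4s : PowerSeries ℚ := PowerSeries.mk fun n => if n = 0 then 1 else 240 * sigmaQ 3 n

/-- The q-expansion of `E₆`. -/
def E6s : PowerSeries ℚ := PowerSeries.mk fun n => if n = 0 then 1 else -504 * sigmaQ 5 n

/-- The q-expansion of the normalized Eisenstein series `E_{p-1}`. -/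
def EAs (p : ℕ) : PowerSeries ℚ :=
  PowerSeries.mk fun n => if n = 0 then 1 else
    -(2 * ((p : ℚ) - 1) / bernoulli (p - 1)) * sigmaQ (p - 2) n

/-- The q-expansion of the normalized Eisenstein series `E_{p+1}`. -/
def EBs (p : ℕ) : PowerSeries ℚ :=
  PowerSeries.mk fun n => if n = 0 then 1 else
    -(2 * ((p : ℚ) + 1) / bernoulli (p + 1)) * sigmaQ p n

/-- `Φ : ℚ[P,Q,R] → ℚ[[q]]`, the algebra map sending `P, Q, R` to `E₂, E₄, E₆`. -/
def Phi : Poly3 →ₐ[ℚ] PowerSeries ℚ := aeval ![E2s, E4s, E6s]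

/-- The theta operator attached to the polynomials `A` and `B`:
`θf = ((BQ-AR)/3)·∂f/∂Q + ((BR-AQ²)/2)·∂f/∂R`. -/
def thetaOp (A B f : Poly3) : Poly3 :=
  C (1/3 : ℚ) * (B * X 1 - A * X 2) * pderiv 1 f
    + C (1/2 : ℚ) * (B * X 2 - A * X 1 ^ 2) * pderiv 2 f

/-- `f` lies in the `n`-th power of the ideal `(A^p, p)` of `ℤ_(p)[P,Q,R]`. -/
def InIdealPow (p : ℕ) (A : Poly3) (n : ℕ) (f : Poly3) : Prop :=
  ∃ G : ℕ → Poly3, (∀ i, polyPInt p (G i)) ∧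
    f = ∑ i ∈ Finset.range (n + 1), (p : Poly3) ^ (n - i) * A ^ (p * i) * G i

namespace Ram
open UpperHalfPlane
open scoped MatrixGroups ModularForm Manifold

lemma hasSum_congr_C {f g : ℕ → ℂ} {a : ℂ} (h : ∀ m, f m = g m) : HasSum f a ↔ HasSum g a := by
  rw [funext h]

/-- `f` is given on the upper half plane by the `q`-series `φ`. -/
def HasQ (f : ℍ → ℂ) (φ : PowerSeries ℂ) : Prop :=
  ∀ τ : ℍ, HasSum (fun m => PowerSeries.coeff m φ • Function.Periodic.qParam 1 (τ : ℂ) ^ m) (f τ)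

lemma HasQ.sub {f g : ℍ → ℂ} {φ ψ : PowerSeries ℂ} (hf : HasQ f φ) (hg : HasQ g ψ) :
    HasQ (f - g) (φ - ψ) := by
  intro τ
  have := (hf τ).sub (hg τ)
  simpa [sub_mul] using this

lemma HasQ.add {f g : ℍ → ℂ} {φ ψ : PowerSeries ℂ} (hf : HasQ f φ) (hg : HasQ g ψ) :
    HasQ (f + g) (φ + ψ) := by
  intro τ
  have := (hf τ).add (hg τ)
  simpa [add_mul] using this

lemma HasQ.smul {f : ℍ → ℂ} {φ : PowerSeries ℂ} (c : ℂ) (hf : HasQ f φ) :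
    HasQ (c • f) (c • φ) := by
  intro τ
  have := (hf τ).const_smul c
  simpa [mul_assoc] using this

lemma HasQ.mul {f g : ℍ → ℂ} {φ ψ : PowerSeries ℂ} (hf : HasQ f φ) (hg : HasQ g ψ) :
    HasQ (f * g) (φ * ψ) := by
  intro τ
  have h1 := (hf τ).summable.norm
  have h2 := (hg τ).summable.norm
  have h3 := tsum_mul_tsum_eq_tsum_sum_antidiagonal_of_summable_norm h1 h2
  have h4 := (summable_norm_sum_mul_antidiagonal_of_summable_norm h1 h2).of_norm.hasSum
  rw [← h3, (hf τ).tsum_eq, (hg τ).tsum_eq] at h4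
  refine (hasSum_congr_C fun m => ?_).mpr h4
  rw [PowerSeries.coeff_mul, Finset.sum_smul]
  refine Finset.sum_congr rfl fun x hx => ?_
  rw [← Finset.HasAntidiagonal.mem_antidiagonal.mp hx, pow_add]
  simp only [smul_eq_mul]; ring

lemma qParam_norm_le {y : ℝ} {w : ℂ} (h : y ≤ w.im) :
    ‖Function.Periodic.qParam 1 w‖ ≤ Real.exp (-2 * Real.pi * y) := by
  rw [Function.Periodic.norm_qParam]
  apply Real.exp_le_exp.mpr
  have := Real.pi_pos
  nlinarith

/-- The derivation `q d/dq` on coefficients. -/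
def thetaC (φ : PowerSeries ℂ) : PowerSeries ℂ := PowerSeries.mk fun n => n * PowerSeries.coeff n φ

lemma HasQ.deriv {f : ℍ → ℂ} {φ : PowerSeries ℂ} (hf : HasQ f φ) :
    HasQ (Derivative.normalizedDerivOfComplex f) (thetaC φ) := by
  intro τ
  set y : ℝ := τ.im / 2 with hy
  have hy0 : 0 < y := by have := τ.im_pos; positivity
  let F : ℕ → ℂ → ℂ := fun m w => PowerSeries.coeff m φ * Function.Periodic.qParam 1 w ^ m
  let U : Set ℂ := {w | y < w.im}
  let τ' : ℍ := ⟨⟨0, y⟩, hy0⟩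
  have hu : Summable fun m => ‖F m (τ' : ℂ)‖ := by
    simpa [F] using (hf τ').summable.norm
  have hq : ∀ w : ℂ, HasDerivAt (Function.Periodic.qParam 1)
      (Function.Periodic.qParam 1 w * (2 * Real.pi * Complex.I)) w := by
    intro w
    unfold Function.Periodic.qParam
    have : HasDerivAt (fun z : ℂ => 2 * Real.pi * Complex.I * z / (1:ℝ)) (2 * Real.pi * Complex.I) w := by
      simpa using (hasDerivAt_id w).const_mul (2 * Real.pi * Complex.I)
    exact this.cexp
  have hd : ∀ m w, HasDerivAt (F m) (PowerSeries.coeff m φ *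
      (m * Function.Periodic.qParam 1 w ^ m * (2 * Real.pi * Complex.I))) w := by
    intro m w
    have := ((hq w).pow m).const_mul (PowerSeries.coeff m φ)
    have e : (m * Function.Periodic.qParam 1 w ^ m * (2 * Real.pi * Complex.I)) =
        (m * Function.Periodic.qParam 1 w ^ (m - 1) *
          (Function.Periodic.qParam 1 w * (2 * Real.pi * Complex.I))) := by
      cases m with
      | zero => simp
      | succ n => rw [Nat.add_sub_cancel, pow_succ]; ring
    rw [e]
    exact this
  have hU : IsOpen U := isOpen_lt continuous_const Complex.continuous_im
  have hτ : (τ : ℂ) ∈ U := by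
    change y < τ.im
    have := τ.im_pos
    rw [hy]; linarith
  have key := Complex.hasSum_deriv_of_summable_norm (F := F) (U := U) (z := (τ : ℂ)) hu
    (fun m w _ => (hd m w).differentiableAt.differentiableWithinAt) hU (by
      intro m w hw
      simp only [F, norm_mul, norm_pow]
      gcongr 2
      refine (qParam_norm_le (le_of_lt hw)).trans (le_of_eq ?_)
      rw [Function.Periodic.norm_qParam]
      simp [τ']) hτ
  have heq : (f ∘ ofComplex) =ᶠ[nhds (τ : ℂ)] fun w => ∑' m, F m w := by
    filter_upwards [hU.mem_nhds hτ] with w hw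
    have hw' : 0 < w.im := hy0.trans hw
    have := (hf ⟨w, hw'⟩).tsum_eq
    simp only [Function.comp, ofComplex_apply_of_im_pos hw', F]
    rw [← this]
    simp [smul_eq_mul]
  have h2 := key.mul_left ((2 * Real.pi * Complex.I)⁻¹)
  rw [← heq.deriv_eq] at h2
  unfold Derivative.normalizedDerivOfComplex
  refine (hasSum_congr_C fun m => ?_).mpr h2
  rw [(hd m τ).deriv]
  have : (2 * Real.pi * Complex.I : ℂ) ≠ 0 := Complex.two_pi_I_ne_zero
  simp only [thetaC, PowerSeries.coeff_mk, smul_eq_mul]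
  field_simp

lemma key {k : ℕ} (hk : k < 12) {G : ℍ → ℂ} {φ : PowerSeries ℂ} (hG : MDiff G)
    (hinv : ∀ γ : SL(2, ℤ), G ∣[(k : ℤ)] γ = G) (hq : HasQ G φ)
    (h0 : PowerSeries.coeff 0 φ = 0) : φ = 0 := by
  let f : ModularForm 𝒮ℒ (k : ℤ) :=
    { toFun := G
      slash_action_eq' := fun _ ⟨γ, hγ⟩ ↦ hγ ▸ hinv γ
      holo' := hG
      bdd_at_cusps' := by
        intro c hc
        rw [Subgroup.IsArithmetic.isCusp_iff_isCusp_SL2Z] at hc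
        rw [OnePoint.isBoundedAt_iff_forall_SL2Z hc]
        intro γ _
        rw [hinv γ]
        exact isBoundedAtImInfty_of_hasSum_qExpansion one_pos hq }
  have hu := ModularFormClass.qExpansion_coeff_unique (f := f) one_pos one_mem_strictPeriods_SL hq
  have hφ : φ = qExpansion 1 f := by ext m; exact hu m
  have hf : f = 0 := by
    apply ModularForm.sturm_bound_levelOne_nat
    rw [← hφ, Nat.div_eq_of_lt hk]
    refine lt_of_lt_of_le (b := (1 : ℕ∞)) (by simp) ?_
    apply PowerSeries.le_order
    intro i hi
    have : i = 0 := by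
      have : i < 1 := by exact_mod_cast hi
      omega
    rw [this, h0]
  rw [hφ, hf]
  exact UpperHalfPlane.qExpansion_zero 1

/-- Complex versions of the `q`-series. -/
def e2 : PowerSeries ℂ := PowerSeries.mk fun n => if n = 0 then 1 else -24 * (ArithmeticFunction.sigma 1 n : ℂ)
def e4 : PowerSeries ℂ := PowerSeries.mk fun n => if n = 0 then 1 else 240 * (ArithmeticFunction.sigma 3 n : ℂ)
def e6 : PowerSeries ℂ := PowerSeries.mk fun n => if n = 0 then 1 else -504 * (ArithmeticFunction.sigma 5 n : ℂ)

lemma hasQ_E2 : HasQ EisensteinSeries.E2 e2 := by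
  intro τ
  have := EisensteinSeries.hasSum_qExpansion_E2 τ
  refine (hasSum_congr_C fun m => ?_).mpr this
  simp [e2, Function.Periodic.qParam]

lemma hasQ_E4 : HasQ ModularForm.E₄ e4 := by
  intro τ
  have := ModularForm.hasSum_qExpansion (f := ModularForm.E₄) one_pos one_mem_strictPeriods_SL τ
  refine (hasSum_congr_C fun m => ?_).mpr this
  rw [EisensteinSeries.E_qExpansion_coeff (by norm_num) (by decide)]
  have : bernoulli 4 = -1/30 := by rw [bernoulli_eq_bernoulli'_of_ne_one (by norm_num), bernoulli'_four]
  rw [this]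
  norm_num [e4]

lemma bern6 : bernoulli 6 = 1/42 := by
  rw [bernoulli_eq_bernoulli'_of_ne_one (by norm_num), bernoulli'_def]
  have h5 : bernoulli' 5 = 0 := bernoulli'_eq_zero_of_odd (by decide) (by norm_num)
  norm_num [Finset.sum_range_succ, bernoulli'_four, h5, Nat.choose]

lemma hasQ_E6 : HasQ ModularForm.E₆ e6 := by
  intro τ
  have := ModularForm.hasSum_qExpansion (f := ModularForm.E₆) one_pos one_mem_strictPeriods_SL τ
  refine (hasSum_congr_C fun m => ?_).mpr this
  rw [EisensteinSeries.E_qExpansion_coeff (by norm_num) (by decide)]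
  rw [bern6]
  norm_num [e6]

lemma inv4 (γ : SL(2, ℤ)) : (ModularForm.E₄ : ℍ → ℂ) ∣[(4:ℤ)] γ = ModularForm.E₄ :=
  SlashInvariantForm.slash_action_eqn ModularForm.E₄ _ ⟨γ, rfl⟩
lemma inv6 (γ : SL(2, ℤ)) : (ModularForm.E₆ : ℍ → ℂ) ∣[(6:ℤ)] γ = ModularForm.E₆ :=
  SlashInvariantForm.slash_action_eqn ModularForm.E₆ _ ⟨γ, rfl⟩

lemma ram4 : thetaC e4 - (4 * 12⁻¹ : ℂ) • (e2 * e4) + (3⁻¹ : ℂ) • e6 = 0 := by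
  have h4 : MDiff (ModularForm.E₄ : ℍ → ℂ) := ModularForm.E₄.holo'
  have h6 : MDiff (ModularForm.E₆ : ℍ → ℂ) := ModularForm.E₆.holo'
  have hs : HasQ (Derivative.serreDerivative (4 : ℤ) ModularForm.E₄) (thetaC e4 - (4 * 12⁻¹ : ℂ) • (e2 * e4)) := by
    convert! hasQ_E4.deriv.sub ((hasQ_E2.mul hasQ_E4).smul (4 * 12⁻¹ : ℂ)) using 1
    ext z
    simp [mul_assoc]
  have hm : MDiff ((3⁻¹ : ℂ) • (ModularForm.E₆ : ℍ → ℂ)) := by simpa using h6.const_smul (3⁻¹ : ℂ)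
  apply key (k := 6) (by norm_num) ((Derivative.serreDerivative_mdifferentiable _ h4).add hm) ?_
    (hs.add (hasQ_E6.smul (3⁻¹ : ℂ)))
  · simp [thetaC, e2, e4, e6, PowerSeries.coeff_zero_eq_constantCoeff_apply]
    norm_num [← PowerSeries.coeff_zero_eq_constantCoeff_apply]
  · intro γ
    have a := Derivative.serreDerivative_slash_invariant (k := 4) h4 (inv4 γ)
    push_cast at a
    rw [SlashAction.add_slash]
    push_cast
    rw [a, ModularForm.SL_smul_slash, inv6]

lemma ram6 : thetaC e6 - (6 * 12⁻¹ : ℂ) • (e2 * e6) + (2⁻¹ : ℂ) • (e4 * e4) = 0 := by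
  have h4 : MDiff (ModularForm.E₄ : ℍ → ℂ) := ModularForm.E₄.holo'
  have h6 : MDiff (ModularForm.E₆ : ℍ → ℂ) := ModularForm.E₆.holo'
  have hs : HasQ (Derivative.serreDerivative (6 : ℤ) ModularForm.E₆) (thetaC e6 - (6 * 12⁻¹ : ℂ) • (e2 * e6)) := by
    convert! hasQ_E6.deriv.sub ((hasQ_E2.mul hasQ_E6).smul (6 * 12⁻¹ : ℂ)) using 1
    ext z
    simp [mul_assoc]
  have hm : MDiff ((2⁻¹ : ℂ) • ((ModularForm.E₄ : ℍ → ℂ) * (ModularForm.E₄ : ℍ → ℂ))) := by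
    simpa using (h4.mul h4).const_smul (2⁻¹ : ℂ)
  apply key (k := 8) (by norm_num) ((Derivative.serreDerivative_mdifferentiable _ h6).add hm) ?_
    (hs.add ((hasQ_E4.mul hasQ_E4).smul (2⁻¹ : ℂ)))
  · simp [thetaC, e2, e4, e6, PowerSeries.coeff_zero_eq_constantCoeff_apply]
    norm_num [← PowerSeries.coeff_zero_eq_constantCoeff_apply]
  · intro γ
    have a := Derivative.serreDerivative_slash_invariant (k := 6) h6 (inv6 γ)
    push_cast at a
    rw [SlashAction.add_slash]
    push_cast
    have b := ModularForm.mul_slash_SL2 4 4 γ ModularForm.E₄ ModularForm.E₄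
    rw [show (4:ℤ) + 4 = 8 by norm_num] at b
    rw [a, ModularForm.SL_smul_slash, b, inv4]


/-- The correction term in the transformation law of `E₂`. -/
def alpha (γ : SL(2, ℤ)) : ℍ → ℂ := (1 / (2 * riemannZeta 2)) • EisensteinSeries.D2 γ

lemma alpha_deriv (γ : SL(2, ℤ)) (z : ℍ) :
    HasDerivAt (alpha γ ∘ ofComplex) ((2 * Real.pi * Complex.I) * (12⁻¹ * alpha γ z ^ 2)) z := by
  have h := (hasDerivAt_denom_zpow (γ : GL (Fin 2) ℝ) (-1) z).const_mul
    ((1 / (2 * riemannZeta 2)) * (2 * Real.pi * Complex.I * (γ 1 0)))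
  have hcomp : (alpha γ ∘ ofComplex) =ᶠ[nhds ↑z]
      fun w ↦ ((1 / (2 * riemannZeta 2)) * (2 * Real.pi * Complex.I * (γ 1 0))) *
        (denom (γ : GL (Fin 2) ℝ) w) ^ (-1 : ℤ) := by
    filter_upwards [isOpen_upperHalfPlaneSet.mem_nhds z.im_pos] with w hw
    simp [alpha, EisensteinSeries.D2, ofComplex_apply_of_im_pos hw]
    ring
  refine HasDerivAt.congr_of_eventuallyEq ?_ hcomp
  convert! h using 1
  have hz := denom_ne_zero (γ : GL (Fin 2) ℝ) z
  have hpi : (Real.pi : ℂ) ≠ 0 := by simp [Real.pi_ne_zero]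
  simp only [alpha, EisensteinSeries.D2, Pi.smul_apply, smul_eq_mul, riemannZeta_two]
  rw [show (-1 : ℤ) - 1 = -2 by norm_num, zpow_neg]
  simp
  field_simp
  simp
  left; norm_num

lemma ram2 : thetaC e2 - (12⁻¹ : ℂ) • (e2 * e2) + (12⁻¹ : ℂ) • e4 = 0 := by
  have h4 : MDiff (ModularForm.E₄ : ℍ → ℂ) := ModularForm.E₄.holo'
  have h2 : MDiff (EisensteinSeries.E2 : ℍ → ℂ) := E2_mdifferentiable
  have hm : MDiff ((12⁻¹ : ℂ) • (ModularForm.E₄ : ℍ → ℂ)) := by simpa using h4.const_smul (12⁻¹ : ℂ)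
  have hm2 : MDiff ((12⁻¹ : ℂ) • (EisensteinSeries.E2 * EisensteinSeries.E2 : ℍ → ℂ)) := by
    simpa using (h2.mul h2).const_smul (12⁻¹ : ℂ)
  apply key (k := 4) (by norm_num)
    (((Derivative.normalizedDerivOfComplex_mdifferentiable h2).sub hm2).add hm) ?_
    ((hasQ_E2.deriv.sub ((hasQ_E2.mul hasQ_E2).smul (12⁻¹ : ℂ))).add (hasQ_E4.smul (12⁻¹ : ℂ)))
  · simp [thetaC, e2, e4, PowerSeries.coeff_zero_eq_constantCoeff_apply]
  · intro γ
    have hE := EisensteinSeries.E2_slash_action γ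
    change _ = EisensteinSeries.E2 - alpha γ at hE
    have a := Derivative.normalizedDerivOfComplex_SL_slash (k := 2) (γ := γ) h2
    rw [show (2:ℤ) + 2 = 4 by norm_num] at a
    have b := ModularForm.mul_slash_SL2 2 2 γ EisensteinSeries.E2 EisensteinSeries.E2
    rw [show (2:ℤ) + 2 = 4 by norm_num] at b
    push_cast
    rw [SlashAction.add_slash, sub_eq_add_neg, SlashAction.add_slash, SlashAction.neg_slash,
      ModularForm.SL_smul_slash, ModularForm.SL_smul_slash, b, inv4]
    rw [hE] at a ⊢
    ext z
    have az := congrFun a z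
    have hd : Derivative.normalizedDerivOfComplex (EisensteinSeries.E2 - alpha γ) z =
        Derivative.normalizedDerivOfComplex EisensteinSeries.E2 z - 12⁻¹ * alpha γ z ^ 2 := by
      have hFz := UpperHalfPlane.mdifferentiableAt_iff.mp (h2 z)
      unfold Derivative.normalizedDerivOfComplex
      rw [show (EisensteinSeries.E2 - alpha γ) ∘ ofComplex =
        EisensteinSeries.E2 ∘ ofComplex - alpha γ ∘ ofComplex from rfl,
        deriv_sub hFz (alpha_deriv γ z).differentiableAt, (alpha_deriv γ z).deriv, mul_sub]
      have : (2 * Real.pi * Complex.I : ℂ) ≠ 0 := Complex.two_pi_I_ne_zero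
      field_simp
    rw [hd] at az
    have hal : ((2 : ℤ) : ℂ) * (2 * Real.pi * Complex.I)⁻¹ * (γ 1 0 / denom γ z) = -6⁻¹ * alpha γ z := by
      have hz := denom_ne_zero (γ : GL (Fin 2) ℝ) z
      have hpi : (Real.pi : ℂ) ≠ 0 := by simp [Real.pi_ne_zero]
      simp only [alpha, EisensteinSeries.D2, Pi.smul_apply, smul_eq_mul, riemannZeta_two]
      field_simp
      ring_nf
      simp
    simp only [Pi.sub_apply] at az
    rw [hal] at az
    simp only [Pi.sub_apply, Pi.add_apply, Pi.neg_apply, Pi.smul_apply, Pi.mul_apply, smul_eq_mul]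
    linear_combination -az


lemma sigmaQ_cast (j n : ℕ) : ((sigmaQ j n : ℚ) : ℂ) = (ArithmeticFunction.sigma j n : ℂ) := by
  simp [sigmaQ, ArithmeticFunction.sigma_apply]

/-- `q d/dq` on rational power series. -/
def theta (φ : PowerSeries ℚ) : PowerSeries ℚ := PowerSeries.mk fun n => n * PowerSeries.coeff n φ

abbrev toC : PowerSeries ℚ →+* PowerSeries ℂ := PowerSeries.map (algebraMap ℚ ℂ)

lemma toC_inj : Function.Injective toC :=
  PowerSeries.map_injective _ (algebraMap ℚ ℂ).injective

lemma toC_theta (φ : PowerSeries ℚ) : toC (theta φ) = thetaC (toC φ) := by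
  ext n; simp [theta, thetaC]

lemma toC_smul (c : ℚ) (φ : PowerSeries ℚ) : toC (c • φ) = (c : ℂ) • toC φ := by
  ext n; simp

lemma toC_E2 : toC E2s = e2 := by
  ext n
  simp only [E2s, e2, PowerSeries.coeff_map, PowerSeries.coeff_mk]
  split_ifs <;> simp [sigmaQ_cast]

lemma toC_E4 : toC E4s = e4 := by
  ext n
  simp only [E4s, e4, PowerSeries.coeff_map, PowerSeries.coeff_mk]
  split_ifs <;> simp [sigmaQ_cast]

lemma toC_E6 : toC E6s = e6 := by
  ext n
  simp only [E6s, e6, PowerSeries.coeff_map, PowerSeries.coeff_mk]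
  split_ifs <;> simp [sigmaQ_cast]

lemma ramanujan2 : theta E2s = (1 / 12 : ℚ) • (E2s ^ 2 - E4s) := by
  apply toC_inj
  rw [toC_theta, toC_smul, map_sub, map_pow, toC_E2, toC_E4]
  push_cast
  have := ram2
  rw [show thetaC e2 = (thetaC e2 - (12⁻¹ : ℂ) • (e2 * e2) + (12⁻¹ : ℂ) • e4) +
    (1 / 12 : ℂ) • (e2 ^ 2 - e4) by rw [one_div, smul_sub, sq]; abel, this, zero_add]

lemma ramanujan4 : theta E4s = (1 / 3 : ℚ) • (E2s * E4s - E6s) := by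
  apply toC_inj
  rw [toC_theta, toC_smul, map_sub, map_mul, toC_E2, toC_E4, toC_E6]
  push_cast
  have := ram4
  rw [show thetaC e4 = (thetaC e4 - (4 * 12⁻¹ : ℂ) • (e2 * e4) + (3⁻¹ : ℂ) • e6) +
    (1 / 3 : ℂ) • (e2 * e4 - e6) by
      rw [show (4 * 12⁻¹ : ℂ) = 3⁻¹ by norm_num, one_div, smul_sub]; abel, this, zero_add]

lemma ramanujan6 : theta E6s = (1 / 2 : ℚ) • (E2s * E6s - E4s ^ 2) := by
  apply toC_inj
  rw [toC_theta, toC_smul, map_sub, map_mul, map_pow, toC_E2, toC_E4, toC_E6]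
  push_cast
  have := ram6
  rw [show thetaC e6 = (thetaC e6 - (6 * 12⁻¹ : ℂ) • (e2 * e6) + (2⁻¹ : ℂ) • (e4 * e4)) +
    (1 / 2 : ℂ) • (e2 * e6 - e4 ^ 2) by
      rw [show (6 * 12⁻¹ : ℂ) = 2⁻¹ by norm_num, one_div, smul_sub, sq]; abel, this, zero_add]

end Ram

namespace Abs

/-- The coefficients in the expansion of `D^n f` in powers of `P / 12`. -/
def tc (w j r : ℕ) : ℕ := (j + r).choose j * (w + r).ascFactorial j

lemma choose_rel (j r : ℕ) :
    (j + r + 1).choose (j + 1) * (j + 1) = (j + r + 1).choose j * (r + 1) := by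
  rw [Nat.choose_succ_right_eq]
  congr 1
  omega

lemma asc_rel (w r j : ℕ) : (w + r).ascFactorial (j + 1) = (w + r) * (w + (r + 1)).ascFactorial j := by
  have := Nat.succ_ascFactorial (w + r) j
  rw [Nat.succ_eq_add_one] at this
  rw [← add_assoc, this, Nat.ascFactorial_succ]

lemma tc_rel1 (w j r : ℕ) : tc w j (r + 1) * ((r + 1) * (w + r)) = tc w (j + 1) r * (j + 1) := by
  unfold tc
  rw [asc_rel, show j + 1 + r = j + r + 1 by ring, ← add_assoc j r 1]
  have := choose_rel j r
  linear_combination ((w + r) * (w + (r + 1)).ascFactorial j) * this.symm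

lemma tc_rel2 (w j r : ℕ) :
    tc w (j + 1) (r + 1) = tc w j (r + 1) * (j + w + 2 * (r + 1)) + tc w (j + 1) r := by
  unfold tc
  rw [asc_rel w r j, Nat.ascFactorial_succ, show j + 1 + (r + 1) = (j + r + 1) + 1 by ring,
    Nat.choose_succ_succ', show j + 1 + r = j + r + 1 by ring, ← add_assoc j r 1]
  have := choose_rel j r
  linear_combination ((w + (r + 1)).ascFactorial j) * this

lemma tc_rel3 (w j : ℕ) : tc w (j + 1) 0 = tc w j 0 * (j + w) := by
  unfold tc
  simp [Nat.ascFactorial_succ]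
  ring

lemma tc_zero (w r : ℕ) : tc w 0 r = 1 := by simp [tc]

section Leibniz
variable {R : Type*} [CommRing R] (D : Derivation ℤ R R)

lemma it_add (n : ℕ) (x y : R) : D^[n] (x + y) = D^[n] x + D^[n] y := iterate_map_add D n x y
lemma it_sub (n : ℕ) (x y : R) : D^[n] (x - y) = D^[n] x - D^[n] y := iterate_map_sub D n x y
lemma it_zero (n : ℕ) : D^[n] (0 : R) = 0 := iterate_map_zero D n

lemma it_nat_mul (n m : ℕ) (x : R) : D^[n] ((m : R) * x) = (m : R) * D^[n] x := by
  rw [← nsmul_eq_mul, ← nsmul_eq_mul]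
  exact iterate_map_nsmul D n x m

lemma it_natpow_mul (n m e : ℕ) (x : R) : D^[n] ((m : R) ^ e * x) = (m : R) ^ e * D^[n] x := by
  rw [← Nat.cast_pow, it_nat_mul]

lemma it_sum {ι : Type*} (n : ℕ) (s : Finset ι) (f : ι → R) :
    D^[n] (∑ i ∈ s, f i) = ∑ i ∈ s, D^[n] (f i) := by
  classical
  induction s using Finset.induction_on with
  | empty => simp
  | insert a s ha ih => rw [Finset.sum_insert ha, Finset.sum_insert ha, it_add, ih]

lemma it_leibniz (n : ℕ) (x y : R) : D^[n] (x * y) =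
    ∑ ij ∈ antidiagonal n, (n.choose ij.1 : R) * (D^[ij.1] x * D^[ij.2] y) := by
  induction n with
  | zero => simp
  | succ n ih =>
    rw [Finset.sum_antidiagonal_choose_succ_mul (fun i j => D^[i] x * D^[j] y),
      Function.iterate_succ_apply', ih, map_sum, ← Finset.sum_add_distrib]
    refine Finset.sum_congr rfl fun ij hij => ?_
    rw [Function.iterate_succ_apply', Function.iterate_succ_apply',
      ← Nat.choose_symm_of_eq_add (mem_antidiagonal.mp hij).symm]
    rw [← nsmul_eq_mul, map_nsmul, D.leibniz, smul_eq_mul, smul_eq_mul, nsmul_eq_mul]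
    ring

end Leibniz

end Abs

namespace Abs

/-- The algebraic data used in the proof. -/
structure Setup (p : ℕ) (R Λ : Type) [CommRing R] [CommRing Λ] where
  D : Derivation ℤ R R
  P : R
  Q : R
  u : R
  A : R
  M : ℕ → AddSubgroup R
  pr : R →+* R
  Φ : R →+* Λ
  hp : p.Prime
  hp5 : 5 ≤ p
  hu : 12 * u = 1
  uM : u ∈ M 0
  QM : Q ∈ M 4
  oneM : 1 ∈ M 0
  AM : A ∈ M (p - 1)
  mulM : ∀ {v w f g}, f ∈ M v → g ∈ M w → f * g ∈ M (v + w)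
  hP : D P = u * (P ^ 2 - Q)
  serre : ∀ {w f}, f ∈ M w → D f - w * (u * P * f) ∈ M (w + 2)
  prP : pr P = 0
  prM : ∀ {w f}, f ∈ M w → pr f = f
  inj : ∀ {w f r}, f ∈ M w → (p : Λ) ^ r ∣ Φ f → (p : R) ^ r ∣ f
  hA : (p : Λ) ∣ Φ A - 1
  th0 : ∀ {x r}, (p : Λ) ^ r ∣ Φ x - 1 → ∀ n, 1 ≤ n → (p : Λ) ^ r ∣ Φ (D^[n] x)
  th1 : ∀ {x e}, (p : Λ) ^ e ∣ Φ (D x) → (p : Λ) ^ (e + 2) ∣ Φ (D^[p ^ 2] x) - Φ (D^[p] x)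
  th2 : ∀ x n, (p : Λ) ∣ Φ (D^[p * n] x) - Φ (D^[n] x)
  cancel : ∀ {x}, (p : R) ∣ A * x → (p : R) ∣ x
  gen : ∀ C : Subring R, P ∈ C → (∀ w f, f ∈ M w → f ∈ C) → ∀ x, x ∈ C
  decomp : ∀ {w f n}, f ∈ M w → f ∈ Ideal.span {A ^ p, (p : R)} ^ n → ∃ g : ℕ → R,
    (∀ i, ∃ w', w' ≡ w [MOD p] ∧ g i ∈ M w') ∧
      f = ∑ i ∈ range (n + 1), (p : R) ^ (n - i) * A ^ (p * i) * g i

namespace Setup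
variable {p : ℕ} {R Λ : Type} [CommRing R] [CommRing Λ] (S : Setup p R Λ)

lemma Du : S.D S.u = 0 := by
  have h : S.D (12 * S.u) = 0 := by rw [S.hu]; simp
  rw [show (12 : R) * S.u = (12 : ℕ) • S.u by simp, map_nsmul] at h
  have : S.u * (12 * S.D S.u) = 0 := by
    rw [nsmul_eq_mul] at h; push_cast at h; rw [h, mul_zero]
  calc S.D S.u = (12 * S.u) * S.D S.u := by rw [S.hu, one_mul]
    _ = 0 := by rw [← this]; ring

/-- `P / 12`. -/
def Y : R := S.u * S.P

lemma DY : S.D S.Y = S.Y ^ 2 - S.u ^ 2 * S.Q := by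
  unfold Y
  rw [S.D.leibniz, S.Du, S.hP]
  simp only [smul_eq_mul]
  ring

lemma prY : S.pr S.Y = 0 := by unfold Y; rw [map_mul, S.prP, mul_zero]

lemma natM {w : ℕ} {f : R} (n : ℕ) (h : f ∈ S.M w) : (n : R) * f ∈ S.M w := by
  rw [← nsmul_eq_mul]; exact AddSubgroup.nsmul_mem _ h n

lemma powM {w : ℕ} {f : R} (n : ℕ) (h : f ∈ S.M w) : f ^ n ∈ S.M (n * w) := by
  induction n with
  | zero => simpa using S.oneM
  | succ n ih => rw [pow_succ, add_mul, one_mul]; exact S.mulM ih h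

lemma castM {v w : ℕ} {f : R} (h : f ∈ S.M v) (e : v = w) : f ∈ S.M w := e ▸ h

/-- The modular components of the iterated derivatives of `f`. -/
def ser (w : ℕ) (f : R) : ℕ → R × R
  | 0 => (0, f)
  | r + 1 => ((ser w f r).2, S.D (ser w f r).2 - (w + 2 * r : ℕ) * (S.u * S.P * (ser w f r).2)
      - (r * (w + (r - 1)) : ℕ) * (S.u ^ 2 * S.Q * (ser w f r).1))

/-- The `r`-th modular component. -/
def co (w : ℕ) (f : R) (r : ℕ) : R := (S.ser w f r).2

lemma co_zero (w : ℕ) (f : R) : S.co w f 0 = f := rfl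

lemma co_one (w : ℕ) (f : R) : S.co w f 1 = S.D f - (w : ℕ) * (S.Y * f) := by
  simp [co, ser, Y]

lemma co_succ (w : ℕ) (f : R) (r : ℕ) : S.co w f (r + 2) =
    S.D (S.co w f (r + 1)) - (w + 2 * (r + 1) : ℕ) * (S.Y * S.co w f (r + 1))
      - ((r + 1) * (w + r) : ℕ) * (S.u ^ 2 * S.Q * S.co w f r) := rfl

lemma D_co (w : ℕ) (f : R) (r : ℕ) : S.D (S.co w f r) =
    S.co w f (r + 1) + (w + 2 * r : ℕ) * (S.Y * S.co w f r)
      + (r * (w + (r - 1)) : ℕ) * (S.u ^ 2 * S.Q * S.co w f (r - 1)) := by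
  cases r with
  | zero => rw [co_one, co_zero]; push_cast; ring
  | succ r => rw [co_succ, Nat.add_sub_cancel]; ring

lemma co_mem {w : ℕ} {f : R} (hf : f ∈ S.M w) (r : ℕ) : S.co w f r ∈ S.M (w + 2 * r) := by
  induction r using Nat.strong_induction_on with
  | _ r ih =>
    match r, ih with
    | 0, _ => exact hf
    | 1, _ => rw [co_one]; exact S.serre hf
    | r + 2, ih =>
      rw [co_succ]
      apply AddSubgroup.sub_mem
      · exact S.castM (S.serre (ih (r + 1) (by omega))) (by ring)
      · apply S.natM
        exact S.castM (S.mulM (S.mulM (S.powM 2 S.uM) S.QM) (ih r (by omega))) (by ring)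

lemma taylor (w : ℕ) (f : R) (n : ℕ) : S.D^[n] f =
    ∑ jr ∈ antidiagonal n, (tc w jr.1 jr.2 : R) * (S.Y ^ jr.1 * S.co w f jr.2) := by
  induction n with
  | zero => simp [tc, co_zero]
  | succ n ih =>
    rw [Function.iterate_succ_apply', ih, map_sum]
    set g : ℕ → R := S.co w f with hg
    have hD : ∀ jr : ℕ × ℕ, S.D ((tc w jr.1 jr.2 : R) * (S.Y ^ jr.1 * g jr.2)) =
        (tc w jr.1 jr.2 * (jr.1 + w + 2 * jr.2) : ℕ) * (S.Y ^ (jr.1 + 1) * g jr.2)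
        + (tc w jr.1 jr.2 : ℕ) * (S.Y ^ jr.1 * g (jr.2 + 1))
        + S.u ^ 2 * S.Q * ((tc w jr.1 jr.2 * (jr.2 * (w + (jr.2 - 1))) : ℕ) * (S.Y ^ jr.1 * g (jr.2 - 1)))
        - S.u ^ 2 * S.Q * ((tc w jr.1 jr.2 * jr.1 : ℕ) * (S.Y ^ (jr.1 - 1) * g jr.2)) := by
      rintro ⟨j, r⟩
      simp only
      rw [← nsmul_eq_mul, map_nsmul, S.D.leibniz, S.D.leibniz_pow, S.DY, S.D_co, nsmul_eq_mul]
      simp only [smul_eq_mul, nsmul_eq_mul]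
      cases j with
      | zero => push_cast; ring
      | succ j => rw [Nat.add_sub_cancel]; push_cast; ring
    simp_rw [hD]
    rw [Finset.sum_sub_distrib, Finset.sum_add_distrib, Finset.sum_add_distrib, ← Finset.mul_sum,
      ← Finset.mul_sum]
    have h34 : ∑ jr ∈ antidiagonal n, ((tc w jr.1 jr.2 * (jr.2 * (w + (jr.2 - 1))) : ℕ) : R) *
          (S.Y ^ jr.1 * g (jr.2 - 1)) =
        ∑ jr ∈ antidiagonal n, ((tc w jr.1 jr.2 * jr.1 : ℕ) : R) * (S.Y ^ (jr.1 - 1) * g jr.2) := by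
      cases n with
      | zero => simp
      | succ m =>
        rw [Finset.Nat.sum_antidiagonal_succ', Finset.Nat.sum_antidiagonal_succ]
        simp only [Nat.add_sub_cancel, tc_rel1]
        simp
    rw [h34, add_sub_cancel_right]
    have hT : ∀ jr ∈ antidiagonal (n + 1), ((tc w jr.1 jr.2 : ℕ) : R) * (S.Y ^ jr.1 * g jr.2) =
        ((if jr.1 = 0 then 0 else tc w (jr.1 - 1) jr.2 * (jr.1 - 1 + w + 2 * jr.2) : ℕ) : R) *
          (S.Y ^ jr.1 * g jr.2) +
        ((if jr.2 = 0 then 0 else tc w jr.1 (jr.2 - 1) : ℕ) : R) * (S.Y ^ jr.1 * g jr.2) := by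
      rintro ⟨j, r⟩ hjr
      rw [HasAntidiagonal.mem_antidiagonal] at hjr
      simp only at hjr ⊢
      rw [← add_mul, ← Nat.cast_add]
      congr 2
      match j, r with
      | 0, 0 => omega
      | 0, r + 1 => simp [tc_zero]
      | j + 1, 0 => simp [tc_rel3]
      | j + 1, r + 1 => simp [tc_rel2]
    rw [Finset.sum_congr rfl hT, Finset.sum_add_distrib]
    congr 1
    · rw [Finset.Nat.sum_antidiagonal_succ]; simp
    · rw [Finset.Nat.sum_antidiagonal_succ']; simp

lemma pr_it {w : ℕ} {f : R} (hf : f ∈ S.M w) (n : ℕ) : S.pr (S.D^[n] f) = S.co w f n := by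
  rw [S.taylor w f n, map_sum]
  rw [Finset.sum_eq_single (0, n)]
  · simp [tc_zero, S.prM (S.co_mem hf n)]
  · rintro ⟨j, r⟩ hjr hne
    rw [HasAntidiagonal.mem_antidiagonal] at hjr
    have : j ≠ 0 := by
      rintro rfl
      apply hne
      simp at hjr
      simp [hjr]
    simp [S.prY, this]
  · intro h; simp at h

end Setup
end Abs

namespace Abs

lemma dvd_choose_mul (n r : ℕ) : n ∣ n.choose r * r := by
  cases r with
  | zero => simp
  | succ r =>
    cases n with
    | zero => simp
    | succ n => exact ⟨_, (Nat.add_one_mul_choose_eq n r).symm⟩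

lemma dvd_choose_of_not_dvd {p n r a : ℕ} (hp : p.Prime) (hn : p ^ a ∣ n) (hr : ¬ p ∣ r) :
    p ^ a ∣ n.choose r :=
  (Nat.Coprime.pow_left a ((hp.coprime_iff_not_dvd).2 hr)).dvd_of_dvd_mul_right
    (hn.trans (dvd_choose_mul n r))

lemma dvd_choose_of_sq {p n r : ℕ} (hp : p.Prime) (hn : p ^ 2 ∣ n) (hr : ¬ p ^ 2 ∣ r) :
    p ∣ n.choose r := by
  by_contra h
  exact hr ((Nat.Coprime.pow_left 2 ((hp.coprime_iff_not_dvd).2 h)).dvd_of_dvd_mul_left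
    (hn.trans (dvd_choose_mul n r)))

lemma pow_dvd_fact {p : ℕ} (hp : p.Prime) (s : ℕ) : p ^ s ∣ (p * s).factorial := by
  induction s with
  | zero => simp
  | succ s ih =>
    rw [pow_succ, mul_add, mul_one]
    exact (mul_dvd_mul ih (Nat.dvd_factorial hp.pos le_rfl)).trans
      (Nat.factorial_mul_factorial_dvd_factorial_add _ _)

lemma pow_dvd_fact' {p : ℕ} (hp : p.Prime) {s n : ℕ} (h : p * s ≤ n) : p ^ s ∣ n.factorial :=
  (pow_dvd_fact hp s).trans (Nat.factorial_dvd_factorial h)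

lemma pow_dvd_asc {p : ℕ} (hp : p.Prime) {s n : ℕ} (h : p * s ≤ n) (a : ℕ) :
    p ^ s ∣ a.ascFactorial n :=
  (pow_dvd_fact' hp h).trans (Nat.factorial_dvd_ascFactorial a n)

lemma dvd_asc {p : ℕ} (hp : p.Prime) {n : ℕ} (h : p ≤ n) (a : ℕ) : p ∣ a.ascFactorial n := by
  simpa using pow_dvd_asc hp (s := 1) (by simpa using h) a

lemma dvd_tc {p : ℕ} (hp : p.Prime) {j r : ℕ} (w : ℕ) (h : p ∣ j + r) (hj : 1 ≤ j) :
    p ∣ tc w j r := by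
  by_cases hpj : p ∣ j
  · exact (dvd_asc hp (Nat.le_of_dvd hj hpj) _).mul_left _
  · have := dvd_choose_of_not_dvd (a := 1) hp (by simpa using h) hpj
    rw [pow_one] at this
    exact this.mul_right _

lemma sq_dvd_tc {p : ℕ} (hp : p.Prime) {j r : ℕ} (w : ℕ) (h : j + r = p ^ 2) (hj : 1 ≤ j)
    (hr : 1 ≤ r) : p ^ 2 ∣ tc w j r := by
  by_cases hpj : p ∣ j
  · rw [pow_two]
    apply mul_dvd_mul
    · apply dvd_choose_of_sq hp (by rw [h])
      intro h2
      have := Nat.le_of_dvd hj h2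
      omega
    · exact dvd_asc hp (Nat.le_of_dvd hj hpj) _
  · exact (dvd_choose_of_not_dvd hp (by rw [h]) hpj).mul_right _

namespace Setup
variable {p : ℕ} {R Λ : Type} [CommRing R] [CommRing Λ] (S : Setup p R Λ)

/-- The ideal `(A^p, p)`. -/
def I : Ideal R := Ideal.span {S.A ^ p, (p : R)}

lemma pI : (p : R) ∈ S.I := Ideal.subset_span (by simp)
lemma ApI : S.A ^ p ∈ S.I := Ideal.subset_span (by simp)

lemma mono {a b : ℕ} (h : a ≤ b) {x : R} (hx : x ∈ S.I ^ b) : x ∈ S.I ^ a :=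
  Ideal.pow_le_pow_right h hx

lemma mulI {a b : ℕ} {x y : R} (hx : x ∈ S.I ^ a) (hy : y ∈ S.I ^ b) : x * y ∈ S.I ^ (a + b) := by
  rw [pow_add]; exact Ideal.mul_mem_mul hx hy

lemma mulI' {a b c : ℕ} {x y : R} (hx : x ∈ S.I ^ a) (hy : y ∈ S.I ^ b) (h : c ≤ a + b) :
    x * y ∈ S.I ^ c := S.mono h (S.mulI hx hy)

lemma ppI (e : ℕ) : (p : R) ^ e ∈ S.I ^ e := Ideal.pow_mem_pow S.pI e

lemma dvdI {e : ℕ} {x : R} (h : (p : R) ^ e ∣ x) : x ∈ S.I ^ e :=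
  Ideal.mem_of_dvd _ h (S.ppI e)

lemma natI {e n : ℕ} (h : p ^ e ∣ n) : (n : R) ∈ S.I ^ e := by
  apply S.dvdI
  have := Nat.cast_dvd_cast (α := R) h
  simpa using this

lemma natI1 {n : ℕ} (h : p ∣ n) : (n : R) ∈ S.I ^ 1 := S.natI (by simpa using h)

lemma ApiI (i : ℕ) : S.A ^ (p * i) ∈ S.I ^ i := by
  rw [pow_mul]; exact Ideal.pow_mem_pow S.ApI i

lemma D_pow_dvd (x : R) : (p : R) ∣ S.D (x ^ p) := by
  rw [S.D.leibniz_pow, nsmul_eq_mul]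
  exact Dvd.intro _ rfl

lemma D_I {x : R} (hx : x ∈ S.I) : S.D x ∈ S.I := by
  obtain ⟨a, b, rfl⟩ := Ideal.mem_span_pair.1 hx
  have h2 : S.D (b * (p : R)) = (p : R) * S.D b := by
    rw [mul_comm, ← nsmul_eq_mul, map_nsmul, nsmul_eq_mul]
  rw [map_add, h2, S.D.leibniz, smul_eq_mul, smul_eq_mul]
  refine add_mem (add_mem ?_ ?_) ?_
  · exact Ideal.mul_mem_left _ _ (Ideal.mem_of_dvd _ (S.D_pow_dvd _) S.pI)
  · exact Ideal.mul_mem_right _ _ S.ApI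
  · exact Ideal.mul_mem_right _ _ S.pI

lemma D_Ipow {n : ℕ} {x : R} (hx : x ∈ S.I ^ n) : S.D x ∈ S.I ^ n := by
  induction n generalizing x with
  | zero => simp
  | succ n ih =>
    rw [pow_succ] at hx ⊢
    induction hx using Submodule.mul_induction_on' with
    | mem_mul_mem a ha b hb =>
      rw [S.D.leibniz, smul_eq_mul, smul_eq_mul]
      refine add_mem (Ideal.mul_mem_mul ha (S.D_I hb)) ?_
      rw [mul_comm b]
      exact Ideal.mul_mem_mul (ih ha) hb
    | add a _ b _ ha hb => rw [map_add]; exact add_mem ha hb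

lemma it_Ipow {n : ℕ} {x : R} (hx : x ∈ S.I ^ n) (r : ℕ) : S.D^[r] x ∈ S.I ^ n := by
  induction r with
  | zero => exact hx
  | succ r ih => rw [Function.iterate_succ_apply']; exact S.D_Ipow ih

lemma it_Ipow_le {n a b : ℕ} {x : R} (hx : S.D^[a] x ∈ S.I ^ n) (h : a ≤ b) :
    S.D^[b] x ∈ S.I ^ n := by
  obtain ⟨c, rfl⟩ := Nat.exists_eq_add_of_le h
  rw [add_comm, Function.iterate_add_apply]
  exact S.it_Ipow hx c

lemma it_dvd {e : ℕ} {x : R} (hx : (p : R) ^ e ∣ x) (r : ℕ) : (p : R) ^ e ∣ S.D^[r] x := by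
  obtain ⟨y, rfl⟩ := hx
  rw [it_natpow_mul]
  exact Dvd.intro _ rfl

lemma it_dvd1 {x : R} (hx : (p : R) ∣ x) (r : ℕ) : (p : R) ∣ S.D^[r] x := by
  have := S.it_dvd (e := 1) (by simpa using hx) r
  simpa using this

lemma it_dvd_of_D {e r : ℕ} {x : R} (hx : (p : R) ^ e ∣ S.D x) (hr : 1 ≤ r) :
    (p : R) ^ e ∣ S.D^[r] x := by
  obtain ⟨r, rfl⟩ := Nat.exists_eq_add_of_le' hr
  rw [Function.iterate_add_apply]
  exact S.it_dvd hx r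

lemma it_Ap_dvd {r : ℕ} (hr : 1 ≤ r) : (p : R) ∣ S.D^[r] (S.A ^ p) := by
  have := S.it_dvd_of_D (e := 1) (r := r) (x := S.A ^ p) (by simp [S.D_pow_dvd S.A]) hr
  simpa using this

lemma prA : S.pr S.A = S.A := S.prM S.AM

lemma prI {n : ℕ} {x : R} (hx : x ∈ S.I ^ n) : S.pr x ∈ S.I ^ n := by
  have h1 : S.I.map S.pr ≤ S.I := by
    unfold I
    rw [Ideal.map_span, Ideal.span_le]
    rintro _ ⟨y, hy, rfl⟩
    simp only [Set.mem_insert_iff, Set.mem_singleton_iff] at hy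
    rcases hy with rfl | rfl
    · rw [map_pow, S.prA]; exact S.ApI
    · rw [map_natCast]; exact S.pI
  have h2 := Ideal.mem_map_of_mem S.pr hx
  rw [Ideal.map_pow] at h2
  exact Ideal.pow_right_mono h1 n h2

lemma co_dvd {w e r : ℕ} {f : R} (hf : f ∈ S.M w) (h : (p : R) ^ e ∣ S.D f) (hr : 1 ≤ r) :
    (p : R) ^ e ∣ S.co w f r := by
  rw [← S.pr_it hf]
  have := map_dvd S.pr (S.it_dvd_of_D h hr)
  simpa using this

lemma co_I {w n a r : ℕ} {f : R} (hf : f ∈ S.M w) (h : S.D^[a] f ∈ S.I ^ n) (hr : a ≤ r) :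
    S.co w f r ∈ S.I ^ n := by
  rw [← S.pr_it hf]
  exact S.prI (S.it_Ipow_le h hr)

lemma leib_mem {n : ℕ} {x y : R} (J : Ideal R)
    (h : ∀ i j, i + j = n → (n.choose i : R) * (S.D^[i] x * S.D^[j] y) ∈ J) :
    S.D^[n] (x * y) ∈ J := by
  rw [it_leibniz]
  apply Ideal.sum_mem
  rintro ⟨i, j⟩ hij
  exact h i j (HasAntidiagonal.mem_antidiagonal.1 hij)

lemma phi_dvd {e : ℕ} {x : R} (h : (p : R) ^ e ∣ x) : (p : Λ) ^ e ∣ S.Φ x := by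
  have := map_dvd S.Φ h
  simpa using this

lemma phi_dvd1 {x : R} (h : (p : R) ∣ x) : (p : Λ) ∣ S.Φ x := by
  have := map_dvd S.Φ h
  simpa using this

/-- The Serre derivative of `A`. -/
def b : R := S.co (p - 1) S.A 1

lemma bM : S.b ∈ S.M (p + 1) := S.castM (S.co_mem S.AM 1) (by have := S.hp5; omega)

lemma DA : S.D S.A = S.b - S.Y * S.A + p * (S.Y * S.A) := by
  unfold b
  rw [co_one, Nat.cast_sub (by have := S.hp5; omega)]
  push_cast
  ring

lemma phi_b : (p : Λ) ∣ S.Φ S.b - S.Φ S.Y := by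
  have h1 : (p : Λ) ∣ S.Φ (S.D S.A) := by
    have := S.th0 (x := S.A) (r := 1) (by simpa using S.hA) 1 le_rfl
    simpa using this
  have h2 := S.hA
  rw [S.DA] at h1
  simp only [map_add, map_sub, map_mul, map_natCast] at h1
  obtain ⟨s, hs⟩ := h1
  obtain ⟨t, ht⟩ := h2
  refine ⟨s + S.Φ S.Y * t - S.Φ S.Y * S.Φ S.A, ?_⟩
  linear_combination hs + S.Φ S.Y * ht

lemma dvd_mul_sub {M : Type*} [CommRing M] {c a a' b b' : M} (h : c ∣ a - a') (h' : c ∣ b - b') :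
    c ∣ a * b - a' * b' := by
  have : a * b - a' * b' = (a - a') * b + a' * (b - b') := by ring
  rw [this]
  exact dvd_add (h.mul_right _) (h'.mul_left _)

lemma dvd_pow_sub {M : Type*} [CommRing M] {c a a' : M} (h : c ∣ a - a') (n : ℕ) :
    c ∣ a ^ n - a' ^ n := h.trans (sub_dvd_pow_sub_pow a a' n)

lemma phi_Apow (n : ℕ) : (p : Λ) ∣ S.Φ S.A ^ n - 1 := by
  simpa using dvd_pow_sub S.hA n

lemma phi_Ap2 : (p : Λ) ^ 2 ∣ S.Φ S.A ^ p - 1 := by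
  have := dvd_sub_pow_of_dvd_sub S.hA 1
  simpa using this

lemma phi_bp2 : (p : Λ) ^ 2 ∣ S.Φ S.b ^ p - S.Φ S.Y ^ p := by
  have := dvd_sub_pow_of_dvd_sub S.phi_b 1
  simpa using this

end Setup
end Abs

namespace Abs
namespace Setup
variable {p : ℕ} {R Λ : Type} [CommRing R] [CommRing Λ] (S : Setup p R Λ)

lemma nat_dvd {e n : ℕ} (h : p ^ e ∣ n) : (p : R) ^ e ∣ (n : R) := by
  have := Nat.cast_dvd_cast (α := R) h
  simpa using this

/-- Separate off the `j = 0` term of the Taylor formula. -/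
lemma taylor_dvd {w n : ℕ} {f : R} (c : R)
    (h : ∀ j r, j + r = n → 1 ≤ j → c ∣ (tc w j r : R) * (S.Y ^ j * S.co w f r)) :
    c ∣ S.D^[n] f - S.co w f n := by
  rw [S.taylor w f n, ← Finset.add_sum_erase _ _ (a := (0, n)) (by simp)]
  simp only [tc_zero, Nat.cast_one, pow_zero, one_mul, add_sub_cancel_left]
  apply Finset.dvd_sum
  rintro ⟨j, r⟩ hjr
  simp only [Finset.mem_erase, HasAntidiagonal.mem_antidiagonal] at hjr
  apply h j r hjr.2
  by_contra hj
  have hj : j = 0 := by omega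
  subst hj
  apply hjr.1
  simpa using hjr.2

lemma L1 {w e : ℕ} {f : R} (he : e ≤ 1) (hf : f ∈ S.M w) (hD : (p : R) ^ e ∣ S.D f)
    (hfI : f ∈ S.I ^ e) :
    ∃ X, (p : R) ^ (e + 2) ∣ S.D^[p ^ 2] f - X ∧ X ∈ S.I ^ (e + 2) ∧
      (p : R) ∣ X - S.A ^ (2 * p) * S.co w f p := by
  have hp := S.hp
  have hp5 := S.hp5
  let T : ℕ × ℕ → R := fun jr =>
    (tc w jr.1 jr.2 : R) * (S.b ^ jr.1 * S.A ^ (2 * p - jr.1) * S.co w f jr.2)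
  let X : R := ∑ jr ∈ antidiagonal p, T jr
  have hXM : X ∈ S.M (w + 2 * p ^ 2) := by
    apply AddSubgroup.sum_mem
    rintro ⟨j, r⟩ hjr
    have hjr := HasAntidiagonal.mem_antidiagonal.1 hjr
    apply S.natM
    refine S.castM (S.mulM (S.mulM (S.powM _ S.bM) (S.powM _ S.AM)) (S.co_mem hf r)) ?_
    simp only at hjr ⊢
    obtain ⟨q, rfl⟩ : ∃ q, p = q + 1 := ⟨p - 1, by omega⟩
    obtain ⟨d, hd⟩ : ∃ d, 2 * (q + 1) - j = d := ⟨_, rfl⟩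
    have hd2 : d = q + 1 + r := by omega
    rw [hd, hd2, Nat.add_sub_cancel]
    have : j = q + 1 - r := by omega
    have hq : (j : ℤ) = q + 1 - r := by omega
    zify
    rw [hq]
    ring
  have h1 : (p : R) ^ (e + 2) ∣ S.D^[p ^ 2] f - S.co w f (p ^ 2) := by
    apply S.taylor_dvd
    intro j r hjr hj
    rcases Nat.eq_zero_or_pos r with rfl | hr
    · apply Dvd.dvd.mul_right
      have : p ^ (e + 2) ∣ tc w j 0 := by
        apply Dvd.dvd.mul_left
        apply pow_dvd_asc hp
        have : j = p * p := by rw [← pow_two]; omega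
        rw [this]
        exact Nat.mul_le_mul_left _ (by omega)
      exact nat_dvd this
    · rw [add_comm e 2, pow_add]
      apply mul_dvd_mul
      · exact nat_dvd (sq_dvd_tc hp w hjr hj hr)
      · exact (S.co_dvd hf hD hr).mul_left _
  have h2 : (p : Λ) ^ (e + 2) ∣ S.Φ (S.D^[p] f) - S.Φ X := by
    rw [S.taylor w f p, ← map_sub, ← Finset.sum_sub_distrib, map_sum]
    apply Finset.dvd_sum
    rintro ⟨j, r⟩ hjr
    have hjr := HasAntidiagonal.mem_antidiagonal.1 hjr
    simp only at hjr
    have hs : S.Φ ((tc w j r : R) * (S.Y ^ j * S.co w f r) - T (j, r)) =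
        (tc w j r : Λ) * S.Φ (S.co w f r) *
          (S.Φ S.Y ^ j - S.Φ S.b ^ j * S.Φ S.A ^ (2 * p - j)) := by
      simp only [T, map_sub, map_mul, map_pow, map_natCast]
      ring
    rw [hs]
    have hYb : ∀ j n, (p : Λ) ∣ S.Φ S.Y ^ j - S.Φ S.b ^ j * S.Φ S.A ^ n := by
      intro j n
      have := dvd_mul_sub (dvd_pow_sub S.phi_b j) (S.phi_Apow n)
      rw [← dvd_neg]
      simpa using this
    rcases Nat.eq_zero_or_pos j with rfl | hj
    · apply mul_dvd_mul
        (a := (p : Λ) ^ e)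
        (c := (p : Λ) ^ 2) _ _ |> (fun h => by rw [pow_add]; exact h)
      · exact (S.phi_dvd (S.co_dvd hf hD (by omega))).mul_left _
      · have := dvd_pow_sub S.phi_Ap2 2
        rw [← dvd_neg]
        rw [← pow_mul, mul_comm p 2] at this
        simpa using this
    · rcases Nat.eq_zero_or_pos r with rfl | hr
      · have hjp : j = p := by omega
        subst hjp
        have h3 : (j : Λ) ^ (1 + 2) ∣ (tc w j 0 : Λ) * S.Φ (S.co w f 0) *
          (S.Φ S.Y ^ j - S.Φ S.b ^ j * S.Φ S.A ^ (2 * j - j)) := by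
          rw [pow_add]
          apply mul_dvd_mul
          · exact (nat_dvd (by simpa using dvd_tc hp w (by simp) hj)).mul_right _
          · have := dvd_mul_sub S.phi_bp2 S.phi_Ap2
            rw [← dvd_neg, show 2 * j - j = j by omega]
            simpa using this
        exact (pow_dvd_pow _ (by omega)).trans h3
      · rw [show e + 2 = 1 + e + 1 by ring, pow_add, pow_add]
        apply mul_dvd_mul
        · apply mul_dvd_mul
          · exact nat_dvd (by simpa using dvd_tc hp w (by simp [hjr]) hj)
          · exact S.phi_dvd (S.co_dvd hf hD hr)
        · simpa using hYb j _
  have h3 := S.th1 (S.phi_dvd hD)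
  have h4 : (p : R) ^ (e + 2) ∣ S.co w f (p ^ 2) - X := by
    apply S.inj (w := w + 2 * p ^ 2)
    · exact AddSubgroup.sub_mem _ (S.co_mem hf _) hXM
    · have h5 := S.phi_dvd h1
      rw [map_sub] at h5 ⊢
      have := dvd_sub (dvd_add h2 h3) h5
      convert this using 1
      ring
  refine ⟨X, ?_, ?_, ?_⟩
  · have := dvd_add h1 h4
    simpa using this
  · apply Ideal.sum_mem
    rintro ⟨j, r⟩ hjr
    have hjr := HasAntidiagonal.mem_antidiagonal.1 hjr
    simp only [T] at hjr ⊢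
    rcases Nat.eq_zero_or_pos j with rfl | hj
    · apply Ideal.mul_mem_left
      rw [pow_zero, one_mul, Nat.sub_zero, mul_comm 2 p]
      exact S.mulI' (S.ApiI 2) (S.dvdI (S.co_dvd hf hD (by omega))) (by omega)
    · apply S.mulI' (S.natI1 (dvd_tc hp w (by simp [hjr]) hj)) (b := e + 1) _ (by omega)
      rw [show 2 * p - j = p + r by omega, pow_add S.A, show S.b ^ j * (S.A ^ p * S.A ^ r) *
        S.co w f r = (S.b ^ j * S.A ^ r) * (S.A ^ (p * 1) * S.co w f r) by ring]
      apply Ideal.mul_mem_left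
      refine S.mulI' (S.ApiI 1) (b := e) ?_ (by omega)
      rcases Nat.eq_zero_or_pos r with rfl | hr
      · exact hfI
      · exact S.dvdI (S.co_dvd hf hD hr)
  · have : X = T (0, p) + ∑ jr ∈ (antidiagonal p).erase (0, p), T jr :=
      (Finset.add_sum_erase _ _ (by simp)).symm
    rw [this]
    have h0 : T (0, p) = S.A ^ (2 * p) * S.co w f p := by simp [T, tc_zero]
    rw [h0, add_sub_cancel_left]
    apply Finset.dvd_sum
    rintro ⟨j, r⟩ hjr
    simp only [Finset.mem_erase, HasAntidiagonal.mem_antidiagonal] at hjr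
    apply Dvd.dvd.mul_right
    have hj : 1 ≤ j := by
      by_contra hj
      have hj : j = 0 := by omega
      subst hj
      apply hjr.1
      simpa using hjr.2
    exact Nat.cast_dvd_cast (dvd_tc hp w (by simp [hjr.2]) hj)

lemma L1_mem {w : ℕ} {f : R} (hf : f ∈ S.M w) : S.D^[p ^ 2] f ∈ S.I ^ 2 := by
  obtain ⟨X, h1, h2, -⟩ := S.L1 (e := 0) (by omega) hf (by simp) (by simp)
  have := add_mem (S.dvdI h1) h2
  simpa using this

lemma L1_Ap : S.D^[p ^ 2] (S.A ^ p) ∈ S.I ^ 3 := by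
  obtain ⟨X, h1, h2, -⟩ := S.L1 (e := 1) (by omega) (S.powM p S.AM)
    (by simp) (by simpa using S.ApI)
  have := add_mem (S.dvdI h1) h2
  simpa using this

lemma L1_mod {w : ℕ} {f : R} (hf : f ∈ S.M w) :
    ∃ c z, S.D^[p ^ 2] f = S.A ^ (2 * p) * c + p * z := by
  obtain ⟨X, h1, -, h2⟩ := S.L1 (e := 0) (by omega) hf (by simp) (by simp)
  obtain ⟨s, hs⟩ := h1
  obtain ⟨t, ht⟩ := h2
  refine ⟨S.co w f p, p * s + t, ?_⟩
  linear_combination hs + ht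

lemma L0 {w k t : ℕ} {g : R} (hg : g ∈ S.M w) (hk : 1 ≤ k) (hpk : 2 * k - 2 ≤ p)
    (hw : w ≡ k [MOD p]) (ht : p + 1 - k ≤ t) : S.D^[p * t] g ∈ S.I := by
  have hp := S.hp
  have hp5 := S.hp5
  obtain ⟨n, hn⟩ : ∃ n, n = p + 1 - k := ⟨_, rfl⟩
  have h1 : (p : R) ∣ S.D^[p * n] g - S.co w g (p * n) := by
    apply S.taylor_dvd
    intro j r hjr hj
    exact (Nat.cast_dvd_cast (dvd_tc hp w (by simp [hjr]) hj)).mul_right _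
  have h2 : (p : R) ∣ S.D^[n] g - S.co w g n := by
    apply S.taylor_dvd
    intro j r hjr hj
    apply Dvd.dvd.mul_right
    apply Nat.cast_dvd_cast
    apply Dvd.dvd.mul_left
    obtain ⟨j, rfl⟩ := Nat.exists_eq_add_of_le' hj
    rw [Nat.ascFactorial_succ]
    apply Dvd.dvd.mul_right
    rw [← Nat.modEq_zero_iff_dvd]
    have h3 : w + r + j ≡ k + (r + j) [MOD p] := by
      rw [add_assoc]; exact Nat.ModEq.add_right _ hw
    refine h3.trans ?_
    rw [show k + (r + j) = p by omega]
    simp [Nat.ModEq]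
  have h3 : (p : Λ) ∣ S.Φ (S.co w g n) - S.Φ (S.A ^ (2 * n) * S.co w g n) := by
    rw [map_mul, map_pow]
    have := (S.phi_Apow (2 * n)).mul_right (S.Φ (S.co w g n))
    rw [← dvd_neg]
    convert this using 1
    ring
  have h4 : (p : R) ∣ S.co w g (p * n) - S.A ^ (2 * n) * S.co w g n := by
    have := S.inj (w := w + 2 * (p * n)) (r := 1)
      (f := S.co w g (p * n) - S.A ^ (2 * n) * S.co w g n) ?_ ?_
    · simpa using this
    · apply AddSubgroup.sub_mem _ (S.co_mem hg _)
      refine S.castM (S.mulM (S.powM _ S.AM) (S.co_mem hg n)) ?_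
      obtain ⟨q, rfl⟩ : ∃ q, p = q + 1 := ⟨p - 1, by omega⟩
      rw [Nat.add_sub_cancel]
      ring
    · have h5 := S.phi_dvd1 h1
      have h6 := S.phi_dvd1 h2
      have h7 := S.th2 g n
      rw [pow_one]
      rw [map_sub] at h5 h6 ⊢
      have := dvd_add (dvd_add (dvd_sub h7 h5) h6) h3
      convert this using 1
      ring
  have h5 : S.D^[p * n] g ∈ S.I := by
    have h6 := Ideal.mem_of_dvd _ (dvd_add h1 h4) S.pI
    have h7 : S.A ^ (2 * n) * S.co w g n ∈ S.I := by
      rw [show 2 * n = p + (2 * n - p) by omega, pow_add]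
      exact Ideal.mul_mem_right _ _ (Ideal.mul_mem_right _ _ S.ApI)
    have := add_mem h6 h7
    simpa using this
  have := S.it_Ipow_le (n := 1) (b := p * t) (by simpa using h5)
    (Nat.mul_le_mul_left p (by omega))
  simpa using this

end Setup
end Abs

namespace Abs
namespace Setup
variable {p : ℕ} {R Λ : Type} [CommRing R] [CommRing Λ] (S : Setup p R Λ)

lemma p2_choose {i j : ℕ} (hij : i + j = p ^ 2) (hi : i ≠ 0) (hj : j ≠ 0) (hp : p.Prime) :
    p ∣ (p ^ 2).choose i :=
  hp.dvd_choose_pow hi (by omega)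

/-- `D^{p²}` is a derivation modulo `p`. -/
lemma leib_p2 (x y : R) : (p : R) ∣ S.D^[p ^ 2] (x * y) - (x * S.D^[p ^ 2] y + S.D^[p ^ 2] x * y) := by
  have hp := S.hp
  have hpos : 0 < p ^ 2 := pow_pos hp.pos 2
  rw [it_leibniz, ← Finset.add_sum_erase _ _ (a := (0, p ^ 2)) (by simp),
    ← Finset.add_sum_erase _ _ (a := (p ^ 2, 0)) (by simp; omega)]
  simp only [Nat.choose_zero_right, Nat.choose_self, Nat.cast_one, one_mul,
    Function.iterate_zero, id_eq]
  rw [← add_assoc, add_sub_cancel_left]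
  apply Finset.dvd_sum
  rintro ⟨i, j⟩ hij
  simp only [Finset.mem_erase, HasAntidiagonal.mem_antidiagonal, ne_eq, Prod.mk.injEq] at hij
  apply Dvd.dvd.mul_right
  exact Nat.cast_dvd_cast (p2_choose hij.2.2 (by omega) (by omega) hp)

lemma LP : S.D^[p ^ 2] S.P ∈ S.I := by
  have hp := S.hp
  have hp5 := S.hp5
  obtain ⟨c1, z1, h1⟩ := S.L1_mod S.AM
  obtain ⟨c2, z2, h2⟩ := S.L1_mod S.bM
  obtain ⟨z3, h3⟩ := S.leib_p2 S.Y S.A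
  have hYA : S.Y * S.A = S.b - S.D S.A + p * (S.Y * S.A) := by
    rw [S.DA]; ring
  have hD : S.D^[p ^ 2] (S.Y * S.A) = S.D^[p ^ 2] S.b - S.D (S.D^[p ^ 2] S.A) +
      p * S.D^[p ^ 2] (S.Y * S.A) := by
    conv_lhs => rw [hYA]
    rw [it_add, it_sub, it_nat_mul, ← Function.iterate_succ_apply, Function.iterate_succ_apply']
  have hDA2 : ∃ z, S.D (S.A ^ (2 * p)) = p * z := by
    rw [mul_comm 2 p, mul_comm p 2, pow_mul]
    exact S.D_pow_dvd _
  obtain ⟨z4, h4⟩ := hDA2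
  have hDD : S.D (S.D^[p ^ 2] S.A) = S.A ^ (2 * p) * S.D c1 + p * (z4 * c1 + S.D z1) := by
    rw [h1, map_add, S.D.leibniz, ← nsmul_eq_mul, map_nsmul, nsmul_eq_mul, h4]
    simp only [smul_eq_mul]
    ring
  obtain ⟨q, hq⟩ : ∃ q, 2 * p = p + q + 1 := ⟨p - 1, by omega⟩
  have hA : S.A ^ (2 * p) = S.A * (S.A ^ p * S.A ^ q) := by rw [hq]; ring
  have h5 : (p : R) ∣ S.D^[p ^ 2] S.Y - S.A ^ p * S.A ^ q * (c2 - S.D c1 - S.Y * c1) := by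
    apply S.cancel
    refine ⟨z2 - (z4 * c1 + S.D z1) + S.D^[p ^ 2] (S.Y * S.A) - z3 - S.Y * z1, ?_⟩
    rw [hA] at h1 h2 hDD
    linear_combination hD - h3 + h2 - hDD - S.Y * h1
  have h6 : S.D^[p ^ 2] S.Y ∈ S.I := by
    have h7 := Ideal.mem_of_dvd _ h5 S.pI
    have h8 : S.A ^ p * S.A ^ q * (c2 - S.D c1 - S.Y * c1) ∈ S.I :=
      Ideal.mul_mem_right _ _ (Ideal.mul_mem_right _ _ S.ApI)
    have := add_mem h7 h8
    simpa using this
  have h9 : S.P = (12 : ℕ) * S.Y := by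
    unfold Y
    push_cast
    rw [← mul_assoc, S.hu, one_mul]
  rw [h9, it_nat_mul]
  exact Ideal.mul_mem_left _ _ h6

lemma it_one {n : ℕ} (hn : 1 ≤ n) : S.D^[n] 1 = 0 := by
  obtain ⟨n, rfl⟩ := Nat.exists_eq_add_of_le' hn
  rw [Function.iterate_add_apply]
  simp

lemma Dp2_R (x : R) : S.D^[p ^ 2] x ∈ S.I := by
  have hpos : 0 < p ^ 2 := pow_pos S.hp.pos 2
  let C : Subring R :=
    { carrier := {x | S.D^[p ^ 2] x ∈ S.I}
      mul_mem' := by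
        intro a b ha hb
        have h1 := Ideal.mem_of_dvd _ (S.leib_p2 a b) S.pI
        have h2 := add_mem h1 (add_mem (Ideal.mul_mem_left _ a hb) (Ideal.mul_mem_right b _ ha))
        simpa using h2
      one_mem' := by
        change S.D^[p ^ 2] 1 ∈ S.I
        rw [S.it_one hpos]; exact zero_mem _
      add_mem' := by
        intro a b ha hb
        change S.D^[p ^ 2] (a + b) ∈ S.I
        rw [it_add]; exact add_mem ha hb
      zero_mem' := by
        change S.D^[p ^ 2] 0 ∈ S.I
        rw [it_zero]; exact zero_mem _
      neg_mem' := by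
        intro a ha
        change S.D^[p ^ 2] (-a) ∈ S.I
        rw [iterate_map_neg]; exact neg_mem ha }
  refine S.gen C S.LP (fun w f hf => ?_) x
  change S.D^[p ^ 2] f ∈ S.I
  have := S.mono (a := 1) (by omega) (S.L1_mem hf)
  simpa using this

lemma Dp2_I {x : R} (hx : x ∈ S.I) : S.D^[p ^ 2] x ∈ S.I ^ 2 := by
  have hp := S.hp
  obtain ⟨a, b, rfl⟩ := Ideal.mem_span_pair.1 hx
  rw [it_add]
  apply add_mem
  · apply S.leib_mem
    intro i j hij
    rcases Nat.eq_zero_or_pos i with rfl | hi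
    · apply Ideal.mul_mem_left
      apply Ideal.mul_mem_left
      rw [show j = p ^ 2 by omega]
      exact S.mono (by omega) S.L1_Ap
    rcases Nat.eq_zero_or_pos j with rfl | hj
    · apply Ideal.mul_mem_left
      rw [show i = p ^ 2 by omega]
      exact S.mulI (a := 1) (b := 1) (by simpa using S.Dp2_R a) (by simpa using S.ApI)
    · apply S.mulI' (S.natI1 (p2_choose hij (by omega) (by omega) hp)) (b := 1) _ (by omega)
      apply Ideal.mul_mem_left
      exact S.it_Ipow (by simpa using S.ApI) _
  · rw [mul_comm, it_nat_mul]
    exact S.mulI (a := 1) (b := 1) (by simpa using S.pI) (by simpa using S.Dp2_R b)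

lemma Dp2_Ipow {n : ℕ} {x : R} (hx : x ∈ S.I ^ n) : S.D^[p ^ 2] x ∈ S.I ^ (n + 1) := by
  have hp := S.hp
  induction n generalizing x with
  | zero => simpa using S.Dp2_R x
  | succ n ih =>
    rw [pow_succ] at hx
    induction hx using Submodule.mul_induction_on' with
    | mem_mul_mem a ha b hb =>
      apply S.leib_mem
      intro i j hij
      rcases Nat.eq_zero_or_pos i with rfl | hi
      · apply Ideal.mul_mem_left
        rw [show j = p ^ 2 by omega]
        exact S.mulI' ha (S.Dp2_I hb) (by omega)
      rcases Nat.eq_zero_or_pos j with rfl | hj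
      · apply Ideal.mul_mem_left
        rw [show i = p ^ 2 by omega]
        exact S.mulI' (ih ha) (b := 1) (by simpa using hb) (by omega)
      · apply S.mulI' (S.natI1 (p2_choose hij (by omega) (by omega) hp)) (b := n + 1) _ (by omega)
        exact S.mulI' (S.it_Ipow ha _) (S.it_Ipow (n := 1) (by simpa using hb) _) (by omega)
    | add a _ b _ ha hb => rw [it_add]; exact add_mem ha hb

lemma L2 {r : ℕ} (hr : p + 1 ≤ r) : S.D^[r] (S.A ^ p) ∈ S.I ^ 2 := by
  have hp := S.hp
  have hp5 := S.hp5
  set f := S.A ^ p with hf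
  have hfM : f ∈ S.M (p * (p - 1)) := S.powM p S.AM
  set w := p * (p - 1) with hw
  set c := tc w p 0 with hc
  have hcp : p ∣ c := dvd_tc hp w (by simp) (by omega)
  have hDf : (p : R) ^ 1 ∣ S.D f := by rw [pow_one]; exact S.D_pow_dvd _
  have h1 : (p : R) ^ 2 ∣ S.D^[p] f - (S.co w f p + c * (S.Y * S.A) ^ p) := by
    rw [S.taylor w f p, ← Finset.add_sum_erase _ _ (a := (0, p)) (by simp),
      ← Finset.add_sum_erase _ _ (a := (p, 0)) (by simp; omega)]
    simp only [tc_zero, Nat.cast_one, pow_zero, one_mul, co_zero]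
    rw [← add_assoc, ← hc, mul_pow, ← hf, add_sub_cancel_left]
    apply Finset.dvd_sum
    rintro ⟨j, r⟩ hjr
    simp only [Finset.mem_erase, HasAntidiagonal.mem_antidiagonal, ne_eq, Prod.mk.injEq] at hjr
    rw [show 2 = 1 + 1 by rfl, pow_add]
    apply mul_dvd_mul
    · rw [pow_one]
      exact Nat.cast_dvd_cast (dvd_tc hp w (by simp [hjr.2.2]) (by omega))
    · exact (S.co_dvd hfM hDf (by omega)).mul_left _
  have h2 : (p : Λ) ^ 2 ∣ S.Φ (S.D^[p] f) := by
    apply S.th0 _ _ (by omega)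
    rw [hf, map_pow]; exact S.phi_Ap2
  have hcL : (p : Λ) ∣ (c : Λ) := Nat.cast_dvd_cast hcp
  have hcR : (p : R) ∣ (c : R) := Nat.cast_dvd_cast hcp
  have h3 : (p : R) ^ 2 ∣ S.co w f p + c * S.b ^ p := by
    apply S.inj (w := p * (p + 1))
    · apply AddSubgroup.add_mem
      · refine S.castM (S.co_mem hfM p) ?_
        obtain ⟨q, rfl⟩ : ∃ q, p = q + 1 := ⟨p - 1, by omega⟩
        rw [hw, Nat.add_sub_cancel]
        ring
      · exact S.natM _ (S.powM _ S.bM)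
    · have h4 := S.phi_dvd h1
      have h5 : (p : Λ) ^ 2 ∣ (c : Λ) * (S.Φ S.b ^ p - S.Φ S.Y ^ p * S.Φ S.A ^ p) := by
        rw [pow_two]
        apply mul_dvd_mul hcL
        have h6 := (S.phi_Apow p).mul_left (S.Φ S.Y ^ p)
        have h7 := dvd_sub (dvd_pow_sub S.phi_b p) h6
        convert h7 using 1
        ring
      have := dvd_add (dvd_sub h2 h4) h5
      convert this using 1
      simp only [map_sub, map_add, map_mul, map_pow, map_natCast]
      ring
  have h4 : (p : R) ^ 2 ∣ S.D^[p + 1] f := by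
    have h5 := dvd_add h1 h3
    have h6 : S.D^[p] f - (S.co w f p + c * (S.Y * S.A) ^ p) + (S.co w f p + c * S.b ^ p) =
      S.D^[p] f - c * ((S.Y * S.A) ^ p - S.b ^ p) := by ring
    rw [h6] at h5
    have h7 := S.it_dvd h5 1
    rw [it_sub, it_nat_mul] at h7
    have h8 : (p : R) ^ 2 ∣ c * S.D^[1] ((S.Y * S.A) ^ p - S.b ^ p) := by
      rw [pow_two]
      apply mul_dvd_mul hcR
      rw [it_sub]
      exact dvd_sub (S.D_pow_dvd _) (S.D_pow_dvd _)
    have h9 := dvd_add h7 h8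
    rw [sub_add_cancel] at h9
    rw [Function.iterate_succ_apply']
    exact h9
  exact S.it_Ipow_le (S.dvdI h4) hr

end Setup
end Abs

namespace Abs
namespace Setup
variable {p : ℕ} {R Λ : Type} [CommRing R] [CommRing Λ] (S : Setup p R Λ)

lemma it_Ap_I {r : ℕ} (hr : 1 ≤ r) : S.D^[r] (S.A ^ p) ∈ S.I ^ 1 :=
  S.dvdI (by simpa using S.it_Ap_dvd hr)

lemma choose_I1 {s r : ℕ} (hr : ¬ p ∣ r) : (((p * s).choose r : ℕ) : R) ∈ S.I ^ 1 :=
  S.natI (dvd_choose_of_not_dvd S.hp (by simp) hr)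

lemma F1 {s i : ℕ} (h : i < s) : S.D^[p * s] (S.A ^ (p * i)) ∈ S.I ^ (i + 1) := by
  have hp := S.hp
  have hp5 := S.hp5
  induction i generalizing s with
  | zero =>
    rw [mul_zero, pow_zero, S.it_one (by have := Nat.mul_pos hp.pos h; omega)]
    exact zero_mem _
  | succ i ih =>
    rw [show S.A ^ (p * (i + 1)) = S.A ^ p * S.A ^ (p * i) by ring]
    apply S.leib_mem
    intro r t hrt
    rcases Nat.eq_zero_or_pos r with rfl | hr
    · apply Ideal.mul_mem_left
      rw [show t = p * s by omega]
      exact S.mulI' (a := 1) (by simpa using S.ApI) (ih (by omega)) (by omega)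
    by_cases hpr : p ∣ r
    · apply Ideal.mul_mem_left
      obtain ⟨a, rfl⟩ := hpr
      have ha : 1 ≤ a := Nat.pos_of_mul_pos_left hr
      rcases Nat.eq_or_lt_of_le ha with rfl | ha
      · have ht : t = p * (s - 1) := by
          rw [Nat.mul_sub]; omega
        rw [ht]
        exact S.mulI' (S.it_Ap_I hr) (ih (by omega)) (by omega)
      · refine S.mulI' (S.L2 ?_) (S.it_Ipow (S.ApiI i) _) (by omega)
        have := Nat.mul_le_mul_left p ha
        omega
    · exact S.mulI' (S.choose_I1 hpr)
        (S.mulI (S.it_Ap_I hr) (S.it_Ipow (S.ApiI i) _)) (by omega)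

lemma F2 {i : ℕ} (h : i < p) : S.D^[p ^ 2] (S.A ^ (p * i)) ∈ S.I ^ (i + 2) := by
  have hp := S.hp
  have hp5 := S.hp5
  induction i with
  | zero =>
    rw [mul_zero, pow_zero, S.it_one (pow_pos hp.pos 2)]
    exact zero_mem _
  | succ i ih =>
    rw [show S.A ^ (p * (i + 1)) = S.A ^ p * S.A ^ (p * i) by ring]
    apply S.leib_mem
    intro r t hrt
    rcases Nat.eq_zero_or_pos r with rfl | hr
    · apply Ideal.mul_mem_left
      rw [show t = p ^ 2 by omega]
      exact S.mulI' (a := 1) (by simpa using S.ApI) (ih (by omega)) (by omega)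
    rcases Nat.eq_zero_or_pos t with rfl | ht
    · apply Ideal.mul_mem_left
      rw [show r = p ^ 2 by omega]
      exact S.mulI' S.L1_Ap (S.it_Ipow (S.ApiI i) 0) (by omega)
    by_cases hpr : p ∣ r
    · obtain ⟨a, rfl⟩ := hpr
      have hch := S.natI1 (p2_choose hrt (by omega) (by omega) hp)
      have ha : 1 ≤ a := Nat.pos_of_mul_pos_left hr
      refine S.mulI' hch (b := i + 2) ?_ (by omega)
      rcases Nat.eq_or_lt_of_le ha with rfl | ha
      · have ht : t = p * (p - 1) := by
          rw [Nat.mul_sub, ← pow_two]; omega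
        rw [ht]
        exact S.mulI' (S.it_Ap_I hr) (S.F1 (by omega)) (by omega)
      · refine S.mulI' (S.L2 ?_) (S.it_Ipow (S.ApiI i) _) (by omega)
        have := Nat.mul_le_mul_left p ha
        omega
    · exact S.mulI' (S.natI (dvd_choose_of_not_dvd hp dvd_rfl hpr))
        (S.mulI (S.it_Ap_I hr) (S.it_Ipow (S.ApiI i) _)) (by omega)

lemma F3a {w k i : ℕ} {g : R} (hg : g ∈ S.M w) (hk : 1 ≤ k) (hpk : 2 * k - 2 ≤ p)
    (hw : w ≡ k [MOD p]) (hi : i + 1 ≤ k) : S.D^[p ^ 2] (S.A ^ (p * i) * g) ∈ S.I ^ (i + 2) := by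
  have hp := S.hp
  have hp5 := S.hp5
  apply S.leib_mem
  intro r t hrt
  rcases Nat.eq_zero_or_pos r with rfl | hr
  · apply Ideal.mul_mem_left
    rw [show t = p ^ 2 by omega]
    exact S.mulI' (S.ApiI i) (S.L1_mem hg) (by omega)
  rcases Nat.eq_zero_or_pos t with rfl | ht
  · apply Ideal.mul_mem_left
    rw [show r = p ^ 2 by omega]
    exact Ideal.mul_mem_right _ _ (S.F2 (by omega))
  by_cases hpr : p ∣ r
  · obtain ⟨s, rfl⟩ := hpr
    refine S.mulI' (S.natI1 (p2_choose hrt (by omega) (by omega) hp)) (b := i + 1) ?_ (by omega)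
    by_cases hs : i < s
    · exact Ideal.mul_mem_right _ _ (S.F1 hs)
    · have ht : t = p * (p - s) := by
        rw [Nat.mul_sub, ← pow_two]; omega
      rw [ht]
      refine S.mulI' (S.it_Ipow (S.ApiI i) _) (b := 1) ?_ (by omega)
      rw [pow_one]
      exact S.L0 hg hk hpk hw (by omega)
  · exact S.mulI' (S.natI (dvd_choose_of_not_dvd hp dvd_rfl hpr))
      (Ideal.mul_mem_right _ _ (S.it_Ipow (S.ApiI i) _)) (by omega)

lemma F3b {w k i : ℕ} {g : R} (hg : g ∈ S.M w) (hk : 1 ≤ k) (hpk : 2 * k - 2 ≤ p)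
    (hw : w ≡ k [MOD p]) (hi : i + 2 ≤ k) :
    S.D^[p ^ 2 - p] (S.A ^ (p * i) * g) ∈ S.I ^ (i + 1) := by
  have hp := S.hp
  have hp5 := S.hp5
  have hn : p ^ 2 - p = p * (p - 1) := by rw [Nat.mul_sub, pow_two, mul_one]
  rw [hn]
  apply S.leib_mem
  intro r t hrt
  by_cases hpr : p ∣ r
  · obtain ⟨s, rfl⟩ := hpr
    apply Ideal.mul_mem_left
    by_cases hs : i < s
    · exact Ideal.mul_mem_right _ _ (S.F1 hs)
    · have ht : t = p * (p - 1 - s) := by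
        rw [Nat.mul_sub p (p - 1)]; omega
      rw [ht]
      refine S.mulI' (S.it_Ipow (S.ApiI i) _) (b := 1) ?_ (by omega)
      rw [pow_one]
      exact S.L0 hg hk hpk hw (by omega)
  · exact S.mulI' (S.choose_I1 hpr)
      (Ideal.mul_mem_right _ _ (S.it_Ipow (S.ApiI i) _)) (by omega)

/-- Divisibility of the Taylor coefficients by `p³`. -/
lemma tc_big {k m j r : ℕ} (hk : 1 ≤ k) (hkp : k ≤ p) (hj : p ≤ j)
    (h : j + r = m * p ^ 2) : p ^ 2 * (j - k).factorial ∣ (k + r).ascFactorial j := by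
  have h1 := Nat.ascFactorial_mul_ascFactorial (k + r) (j - k) k
  rw [show k + r + (j - k) = m * p ^ 2 by omega, show j - k + k = j by omega] at h1
  rw [← h1, mul_comm]
  apply mul_dvd_mul (Nat.factorial_dvd_ascFactorial _ _)
  obtain ⟨k, rfl⟩ := Nat.exists_eq_add_of_le' hk
  have h2 := asc_rel (m * p ^ 2) 0 k
  rw [add_zero] at h2
  rw [h2]
  exact (Dvd.intro_left m rfl).mul_right _

lemma tail_mem {k m : ℕ} {F : R} (hF : F ∈ S.M k) (hk : 1 ≤ k) (hpk : 2 * k - 2 ≤ p)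
    (hm : 1 ≤ m) (hm2 : 2 * m + 2 ≤ k)
    (h1 : S.D^[m * p ^ 2 - p] F ∈ S.I ^ (2 * m - 1))
    (h2 : S.D^[(m - 1) * p ^ 2] F ∈ S.I ^ (2 * m - 2)) :
    S.D^[m * p ^ 2] F - S.co k F (m * p ^ 2) ∈ S.I ^ (2 * m + 1) := by
  have hp := S.hp
  have hp5 := S.hp5
  have hkp : k ≤ p := by omega
  rw [S.taylor k F, ← Finset.add_sum_erase _ _ (a := (0, m * p ^ 2)) (by simp)]
  simp only [tc_zero, Nat.cast_one, pow_zero, one_mul, add_sub_cancel_left]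
  apply Ideal.sum_mem
  rintro ⟨j, r⟩ hjr
  simp only [Finset.mem_erase, HasAntidiagonal.mem_antidiagonal, ne_eq, Prod.mk.injEq] at hjr
  obtain ⟨hj0, hjr⟩ := hjr
  have hj : 1 ≤ j := by omega
  simp only
  have hmp : (m - 1) * p ^ 2 + p ^ 2 = m * p ^ 2 := by
    rw [Nat.sub_mul, one_mul]
    exact Nat.sub_add_cancel (Nat.le_mul_of_pos_left _ hm)
  have hpp : p * p = p ^ 2 := (pow_two p).symm
  rcases lt_or_ge j p with hjp | hjp
  · refine S.mulI' (a := 2) (b := 2 * m - 1) ?_ ?_ (by omega)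
    · apply S.natI
      apply Dvd.dvd.mul_right
      apply dvd_choose_of_not_dvd hp
      · rw [hjr]; exact Dvd.intro_left m rfl
      · intro hd
        have := Nat.le_of_dvd hj hd
        omega
    · apply Ideal.mul_mem_left
      exact S.co_I hF h1 (by omega)
  rcases le_or_gt j (p ^ 2) with hjq | hjq
  · refine S.mulI' (a := 3) (b := 2 * m - 2) ?_ ?_ (by omega)
    · apply S.natI
      have hb := tc_big hk hkp hjp hjr
      unfold tc
      by_cases hq : p ^ 2 ∣ j
      · have : j = p ^ 2 := le_antisymm hjq (Nat.le_of_dvd hj hq)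
        apply Dvd.dvd.mul_left
        refine dvd_trans ?_ hb
        rw [pow_succ]
        apply mul_dvd_mul_left
        apply Nat.dvd_factorial hp.pos
        rw [this, pow_two]
        nlinarith [Nat.sub_add_cancel (show k ≤ p * p by nlinarith)]
      · rw [show p ^ 3 = p * p ^ 2 by ring]
        apply mul_dvd_mul
        · apply dvd_choose_of_sq hp _ hq
          rw [hjr]; exact Dvd.intro_left m rfl
        · exact (Dvd.intro _ rfl).trans hb
    · apply Ideal.mul_mem_left
      exact S.co_I hF h2 (by omega)
  · apply Ideal.mul_mem_right
    apply S.mono (show 2 * m + 1 ≤ 2 + (p - 1) by omega)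
    apply S.natI
    have hb := tc_big hk hkp hjp hjr
    apply Dvd.dvd.mul_left
    refine dvd_trans ?_ hb
    rw [pow_add]
    apply mul_dvd_mul_left
    apply pow_dvd_fact' hp
    rw [Nat.mul_sub, hpp]
    omega

lemma step {k m : ℕ} {F : R} (hF : F ∈ S.M k) (hk : 1 ≤ k) (hpk : 2 * k - 2 ≤ p)
    (hm2 : 2 * m + 2 ≤ k)
    (h0 : S.D^[m * p ^ 2] F ∈ S.I ^ (2 * m))
    (h1 : S.D^[m * p ^ 2] F - S.co k F (m * p ^ 2) ∈ S.I ^ (2 * m + 1)) :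
    S.D^[(m + 1) * p ^ 2 - p] F ∈ S.I ^ (2 * m + 1) ∧
    S.D^[(m + 1) * p ^ 2] F ∈ S.I ^ (2 * m + 2) := by
  have hp := S.hp
  have hp5 := S.hp5
  obtain ⟨T, hT⟩ : ∃ T, T = S.D^[m * p ^ 2] F - S.co k F (m * p ^ 2) := ⟨_, rfl⟩
  have hF2 : S.D^[m * p ^ 2] F = S.co k F (m * p ^ 2) + T := by rw [hT]; ring
  have hTI : T ∈ S.I ^ (2 * m + 1) := by rw [hT]; exact h1
  obtain ⟨g, hg, hsum⟩ := S.decomp (S.co_mem hF (m * p ^ 2)) (S.co_I hF h0 le_rfl)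
  have hg' : ∀ i, ∃ w', w' ≡ k [MOD p] ∧ g i ∈ S.M w' := by
    intro i
    obtain ⟨w', hw', hgi⟩ := hg i
    refine ⟨w', hw'.trans ?_, hgi⟩
    have : k + 2 * (m * p ^ 2) = k + p * (2 * m * p) := by ring
    rw [this]
    simp [Nat.ModEq]
  have hpp : p ≤ p ^ 2 := by nlinarith
  constructor
  · rw [show (m + 1) * p ^ 2 - p = (p ^ 2 - p) + m * p ^ 2 by rw [add_mul, one_mul]; omega,
      Function.iterate_add_apply, hF2, it_add]
    refine add_mem ?_ (S.it_Ipow hTI _)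
    rw [hsum, it_sum]
    apply Ideal.sum_mem
    intro i hi
    obtain ⟨w', hw', hgi⟩ := hg' i
    have hi := Finset.mem_range.1 hi
    rw [mul_assoc, it_natpow_mul]
    exact S.mulI' (S.ppI _) (S.F3b hgi hk hpk hw' (by omega)) (by omega)
  · rw [show (m + 1) * p ^ 2 = p ^ 2 + m * p ^ 2 by ring,
      Function.iterate_add_apply, hF2, it_add]
    refine add_mem ?_ (S.Dp2_Ipow hTI)
    rw [hsum, it_sum]
    apply Ideal.sum_mem
    intro i hi
    obtain ⟨w', hw', hgi⟩ := hg' i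
    have hi := Finset.mem_range.1 hi
    rw [mul_assoc, it_natpow_mul]
    exact S.mulI' (S.ppI _) (S.F3a hgi hk hpk hw' (by omega)) (by omega)

lemma main {k : ℕ} {F : R} (hF : F ∈ S.M k) (hk : 1 ≤ k) (hpk : 2 * k - 2 ≤ p) (m : ℕ)
    (hm : 2 * m ≤ k - 2) : S.D^[m * p ^ 2] F ∈ S.I ^ (2 * m) ∧
      (1 ≤ m → S.D^[m * p ^ 2 - p] F ∈ S.I ^ (2 * m - 1)) ∧
      (1 ≤ m → S.D^[(m - 1) * p ^ 2] F ∈ S.I ^ (2 * m - 2)) := by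
  induction m with
  | zero => simp
  | succ m ih =>
    obtain ⟨h0, h1, h2⟩ := ih (by omega)
    have h3 : S.D^[m * p ^ 2] F - S.co k F (m * p ^ 2) ∈ S.I ^ (2 * m + 1) := by
      rcases Nat.eq_zero_or_pos m with rfl | hm'
      · simp [co_zero]
      · exact S.tail_mem hF hk hpk hm' (by omega) (h1 hm') (h2 hm')
    obtain ⟨h4, h5⟩ := S.step hF hk hpk (by omega) h0 h3
    exact ⟨h5, fun _ => h4, fun _ => h0⟩

end Setup
end Abs

namespace Inst
variable (p : ℕ) [hpF : Fact p.Prime]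

/-- The local ring `ℤ_(p)`, as a subring of `ℚ`. -/
def Tp : Subring ℚ where
  carrier := {x | pInt p x}
  mul_mem' := by
    intro a b ha hb h
    exact ((Nat.Prime.dvd_mul hpF.out).1 (h.trans (Rat.mul_den_dvd a b))).elim ha hb
  one_mem' := by
    intro h
    exact hpF.out.one_lt.ne' (by simpa using h)
  add_mem' := by
    intro a b ha hb h
    exact ((Nat.Prime.dvd_mul hpF.out).1 (h.trans (Rat.add_den_dvd a b))).elim ha hb
  zero_mem' := by
    intro h
    exact hpF.out.one_lt.ne' (by simpa using h)
  neg_mem' := by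
    intro a ha h
    exact ha (by simpa using h)

variable {p}

lemma mem_Tp {x : ℚ} : x ∈ Tp p ↔ ¬ p ∣ x.den := Iff.rfl

lemma inv_mem {n : ℕ} (hn : ¬ p ∣ n) : ((n : ℚ)⁻¹) ∈ Tp p := by
  rw [mem_Tp, Rat.inv_natCast_den_of_pos]
  · exact hn
  · rcases Nat.eq_zero_or_pos n with rfl | h
    · simp at hn
    · exact h

lemma p_dvd_of_num {x : Tp p} (h : (p : ℤ) ∣ (x : ℚ).num) : (p : Tp p) ∣ x := by
  obtain ⟨m, hm⟩ := h
  have h1 := inv_mem x.2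
  refine ⟨(m : Tp p) * ⟨_, h1⟩, ?_⟩
  apply Subtype.ext
  push_cast
  rw [← mul_assoc]
  have : ((p : ℚ) * m) = (x : ℚ).num := by rw [hm]; push_cast; rfl
  rw [this, ← div_eq_mul_inv, Rat.num_div_den]

lemma inv_mem' {x : ℚ} (h : ¬ (p : ℤ) ∣ x.num) : x⁻¹ ∈ Tp p := by
  have h1 : ¬ p ∣ x.num.natAbs := fun h2 => h (Int.natCast_dvd.2 h2)
  have h2 := inv_mem h1
  have h3 : ((x.num : ℚ))⁻¹ ∈ Tp p := by
    rcases Int.natAbs_eq x.num with h4 | h4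
    · rw [h4]; simpa using h2
    · rw [h4]; push_cast; rw [inv_neg]; exact neg_mem (by simpa using h2)
  have : x⁻¹ = x.den * ((x.num : ℚ))⁻¹ := by
    conv_lhs => rw [← Rat.num_div_den x, inv_div]
    rw [div_eq_mul_inv]
  rw [this]
  exact mul_mem (natCast_mem _ _) h3

lemma not_dvd_inv {x : Tp p} (h : ¬ (p : Tp p) ∣ x) : ∃ y : Tp p, x * y = 1 := by
  have h1 : ¬ (p : ℤ) ∣ (x : ℚ).num := fun h2 => h (p_dvd_of_num h2)
  refine ⟨⟨_, inv_mem' h1⟩, Subtype.ext ?_⟩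
  push_cast
  apply mul_inv_cancel₀
  intro h0
  rw [h0] at h1
  simp at h1

lemma p_not_unit : ¬ IsUnit (p : Tp p) := by
  intro h
  obtain ⟨y, hy⟩ := h.exists_right_inv
  have hp := hpF.out
  have h1 : (p : ℚ) * y = 1 := by
    have := congrArg (Subtype.val) hy
    push_cast at this
    exact this
  have h2 : (y : ℚ) = (p : ℚ)⁻¹ := by
    exact eq_inv_of_mul_eq_one_right h1
  have h3 := y.2
  rw [mem_Tp, h2, Rat.inv_natCast_den_of_pos hp.pos] at h3
  exact h3 dvd_rfl

lemma p_prime : Prime (p : Tp p) := by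
  refine ⟨?_, p_not_unit, ?_⟩
  · exact_mod_cast (Nat.cast_ne_zero (R := Tp p)).2 hpF.out.ne_zero
  · intro a b h
    by_contra! hc
    obtain ⟨x, hx⟩ := not_dvd_inv hc.1
    obtain ⟨y, hy⟩ := not_dvd_inv hc.2
    apply p_not_unit (p := p)
    apply isUnit_of_dvd_one
    refine h.trans ⟨x * y, ?_⟩
    calc (1 : Tp p) = (a * x) * (b * y) := by rw [hx, hy, one_mul]
      _ = _ := by ring

lemma p_mul_bernoulli (hp5 : 5 ≤ p) : ∃ t ∈ Tp p, (p : ℚ) * bernoulli (p - 1) = -1 + p * t := by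
  have hp := hpF.out
  have hodd : Odd p := hp.odd_of_ne_two (by omega)
  obtain ⟨k, hk⟩ := hodd
  have hk2 : p - 1 = 2 * k := by omega
  obtain ⟨N, hN⟩ := Bernoulli.vonStaudt_clausen k
  have hmem : p ∈ (range (2 * k + 2)).filter (fun q => q.Prime ∧ (q - 1) ∣ 2 * k) := by
    simp [hp, ← hk2]; omega
  rw [← Finset.add_sum_erase _ _ hmem] at hN
  refine ⟨N - ∑ q ∈ ((range (2 * k + 2)).filter (fun q => q.Prime ∧ (q - 1) ∣ 2 * k)).erase p,
    (1 : ℚ) / q, ?_, ?_⟩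
  · refine sub_mem (intCast_mem _ _) (sum_mem ?_)
    intro q hq
    rw [one_div]
    apply inv_mem
    simp only [mem_erase, mem_filter] at hq
    intro h
    exact hq.1 (((Nat.prime_dvd_prime_iff_eq hp hq.2.2.1).1 h).symm)
  · rw [hk2, hN]
    have : (p : ℚ) ≠ 0 := by exact_mod_cast hp.ne_zero
    field_simp
    ring

lemma eis_const (hp5 : 5 ≤ p) : ∃ t ∈ Tp p, 2 * ((p : ℚ) - 1) / bernoulli (p - 1) = p * t := by
  obtain ⟨t, ht, h⟩ := p_mul_bernoulli (p := p) hp5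
  have hp0 : (p : ℚ) ≠ 0 := by exact_mod_cast hpF.out.ne_zero
  have h1 : ¬ (p : Tp p) ∣ (-1 + p * ⟨t, ht⟩ : Tp p) := by
    intro hd
    have h2 : (p : Tp p) ∣ 1 := by
      have h3 := dvd_sub (Dvd.intro (⟨t, ht⟩ : Tp p) rfl : (p : Tp p) ∣ _) hd
      simpa using h3
    exact p_not_unit (isUnit_of_dvd_one h2)
  obtain ⟨y, hy⟩ := not_dvd_inv h1
  have hy' : ((p : ℚ) * bernoulli (p - 1)) * y = 1 := by
    have := congrArg Subtype.val hy
    push_cast at this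
    rw [h]; exact this
  refine ⟨2 * ((p : ℚ) - 1) * y, ?_, ?_⟩
  · exact mul_mem (mul_mem (by exact_mod_cast natCast_mem (Tp p) 2)
      (sub_mem (natCast_mem _ _) (one_mem _))) y.2
  · have hB : bernoulli (p - 1) ≠ 0 := by
      intro h0; rw [h0] at hy'; simp at hy'
    rw [div_eq_iff hB]
    linear_combination (-2 * ((p : ℚ) - 1)) * hy'

/-- The polynomial ring `ℤ_(p)[P,Q,R]`. -/
abbrev Rp (p : ℕ) [Fact p.Prime] : Type := MvPolynomial (Fin 3) (Tp p)
/-- The power series ring `ℤ_(p)[[q]]`. -/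
abbrev Lp (p : ℕ) [Fact p.Prime] : Type := PowerSeries (Tp p)

/-- The inclusion into `ℚ[P,Q,R]`. -/
def io : Rp p →+* Poly3 := MvPolynomial.map (Tp p).subtype

lemma io_inj : Function.Injective (io (p := p)) :=
  MvPolynomial.map_injective _ (Subtype.val_injective)

lemma io_pInt (x : Rp p) : polyPInt p (io x) := by
  intro m
  unfold io
  rw [coeff_map]
  exact (coeff m x).2

lemma exists_io {f : Poly3} (hf : polyPInt p f) : ∃ x : Rp p, io x = f := by
  refine ⟨∑ m ∈ f.support, monomial m ⟨coeff m f, hf m⟩, ?_⟩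
  rw [map_sum]
  conv_rhs => rw [f.as_sum]
  apply Finset.sum_congr rfl
  intro m _
  simp [io, map_monomial]

lemma coeff_io (x : Rp p) (m : Fin 3 →₀ ℕ) : coeff m (io x) = coeff m x := by
  unfold io; rw [coeff_map]; rfl

lemma pdvd {r : ℕ} {φ : Lp p} : (p : Lp p) ^ r ∣ φ ↔
    ∀ n, (p : Tp p) ^ r ∣ PowerSeries.coeff n φ := by
  have hC : (p : Lp p) ^ r = PowerSeries.C ((p : Tp p) ^ r) := by simp
  rw [hC]
  constructor
  · rintro ⟨ψ, rfl⟩ n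
    rw [PowerSeries.coeff_C_mul]
    exact Dvd.intro _ rfl
  · intro h
    choose g hg using h
    refine ⟨PowerSeries.mk g, ?_⟩
    ext n
    rw [PowerSeries.coeff_C_mul, PowerSeries.coeff_mk, hg]

/-- The invertible constant `1/12`. -/
def u0 (hp5 : 5 ≤ p) : Tp p := ⟨((12 : ℕ) : ℚ)⁻¹, inv_mem (by
  intro h
  have hp := hpF.out
  rw [show 12 = 2 * 2 * 3 by rfl, hp.dvd_mul, hp.dvd_mul] at h
  have h2 : ¬ p ∣ 2 := fun h => by have := Nat.le_of_dvd (by norm_num) h; omega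
  have h3 : ¬ p ∣ 3 := fun h => by have := Nat.le_of_dvd (by norm_num) h; omega
  tauto)⟩

lemma u0_spec (hp5 : 5 ≤ p) : 12 * u0 (p := p) hp5 = 1 := by
  apply Subtype.ext
  have h12 : (((12 : ℕ) : Tp p) : ℚ) = ((12 : ℕ) : ℚ) := Subring.coe_natCast _ _
  have h : (((12 : ℕ) : Tp p) : ℚ) * ((12 : ℕ) : ℚ)⁻¹ = 1 := by
    rw [h12]; norm_num
  exact h

end Inst

namespace Inst
variable {p : ℕ} [hpF : Fact p.Prime]

/-- The Ramanujan derivation on `ℤ_(p)[P,Q,R]`. -/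
def Dp0 (hp5 : 5 ≤ p) : Derivation (Tp p) (Rp p) (Rp p) :=
  mkDerivation (Tp p) ![C (u0 hp5) * (X 0 ^ 2 - X 1), 4 * C (u0 hp5) * (X 0 * X 1 - X 2),
    6 * C (u0 hp5) * (X 0 * X 2 - X 1 ^ 2)]

/-- The same derivation, over `ℤ`. -/
def Dp (hp5 : 5 ≤ p) : Derivation ℤ (Rp p) (Rp p) := (Dp0 hp5).restrictScalars ℤ

lemma Dp_apply (hp5 : 5 ≤ p) (x : Rp p) : Dp hp5 x = Dp0 hp5 x := rfl

lemma Dp_C (hp5 : 5 ≤ p) (t : Tp p) : Dp hp5 (C t) = 0 := by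
  exact (Dp0 hp5).map_algebraMap t

lemma Dp_0 (hp5 : 5 ≤ p) : Dp hp5 (X 0) = C (u0 hp5) * (X 0 ^ 2 - X 1) := by
  rw [Dp_apply, Dp0, mkDerivation_X]; rfl
lemma Dp_1 (hp5 : 5 ≤ p) : Dp hp5 (X 1) = 4 * C (u0 hp5) * (X 0 * X 1 - X 2) := by
  rw [Dp_apply, Dp0, mkDerivation_X]; rfl
lemma Dp_2 (hp5 : 5 ≤ p) : Dp hp5 (X 2) = 6 * C (u0 hp5) * (X 0 * X 2 - X 1 ^ 2) := by
  rw [Dp_apply, Dp0, mkDerivation_X]; rfl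

lemma Dop_add (f g : Poly3) : Dop (f + g) = Dop f + Dop g := by
  unfold Dop; simp only [map_add]; ring
lemma Dop_mul (f g : Poly3) : Dop (f * g) = f * Dop g + g * Dop f := by
  unfold Dop; simp only [Derivation.leibniz, smul_eq_mul]; ring
lemma Dop_C (c : ℚ) : Dop (C c) = 0 := by
  unfold Dop; simp
lemma Dop_0 : Dop (X 0) = C (1/12 : ℚ) * (X 0 ^ 2 - X 1) := by
  unfold Dop; simp [pderiv_X]
lemma Dop_1 : Dop (X 1) = C (1/3 : ℚ) * (X 0 * X 1 - X 2) := by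
  unfold Dop; simp [pderiv_X]
lemma Dop_2 : Dop (X 2) = C (1/2 : ℚ) * (X 0 * X 2 - X 1 ^ 2) := by
  unfold Dop; simp [pderiv_X]

lemma io_X (i : Fin 3) : io (X i : Rp p) = X i := by simp [io]
lemma io_C (t : Tp p) : io (C t : Rp p) = C (t : ℚ) := by simp [io]

lemma io_D (hp5 : 5 ≤ p) (x : Rp p) : io (Dp hp5 x) = Dop (io x) := by
  have h4 : (4 : Poly3) = C (4 : ℚ) := (map_ofNat C 4).symm
  have h6 : (6 : Poly3) = C (6 : ℚ) := (map_ofNat C 6).symm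
  induction x using MvPolynomial.induction_on with
  | C t => rw [Dp_C, io_C, Dop_C, map_zero]
  | add f g hf hg => rw [map_add, map_add, map_add, Dop_add, hf, hg]
  | mul_X f i hf =>
    rw [Derivation.leibniz, map_mul io f, Dop_mul, map_add, smul_eq_mul, smul_eq_mul, map_mul,
      map_mul, hf, io_X]
    congr 2
    fin_cases i
    · simp only [Fin.zero_eta]
      rw [Dp_0, Dop_0, map_mul, map_sub, map_pow, io_X, io_X, io_C]
      simp [u0]
    · simp only [Fin.mk_one]
      rw [Dp_1, Dop_1, map_mul, map_mul, map_sub, map_mul, io_X, io_X, io_X, io_C, map_ofNat, h4,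
        ← C_mul]
      norm_num [u0]
    · simp only [Fin.reduceFinMk]
      rw [Dp_2, Dop_2, map_mul, map_mul, map_sub, map_mul, map_pow, io_X, io_X, io_X, io_C,
        map_ofNat, h6, ← C_mul]
      norm_num [u0]

lemma io_it (hp5 : 5 ≤ p) (n : ℕ) (x : Rp p) : io ((Dp hp5)^[n] x) = Dop^[n] (io x) := by
  induction n with
  | zero => rfl
  | succ n ih => rw [Function.iterate_succ_apply', Function.iterate_succ_apply', io_D, ih]

lemma theta_add (f g : PowerSeries ℚ) : Ram.theta (f + g) = Ram.theta f + Ram.theta g := by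
  ext n; simp [Ram.theta]; ring

lemma theta_C (c : ℚ) : Ram.theta (PowerSeries.C c) = 0 := by
  ext n
  simp only [Ram.theta, PowerSeries.coeff_mk, PowerSeries.coeff_C]
  split_ifs with h
  · simp [h]
  · simp

lemma theta_mul (f g : PowerSeries ℚ) :
    Ram.theta (f * g) = f * Ram.theta g + g * Ram.theta f := by
  ext n
  rw [map_add, mul_comm g]
  simp only [Ram.theta, PowerSeries.coeff_mk, PowerSeries.coeff_mul]
  rw [Finset.mul_sum, ← Finset.sum_add_distrib]
  apply Finset.sum_congr rfl
  rintro ⟨i, j⟩ hij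
  have := HasAntidiagonal.mem_antidiagonal.1 hij
  simp only at this ⊢
  rw [← this]
  push_cast
  ring

lemma Phi_0 : Phi (X 0) = E2s := by simp [Phi]
lemma Phi_1 : Phi (X 1) = E4s := by simp [Phi]
lemma Phi_2 : Phi (X 2) = E6s := by simp [Phi]
lemma Phi_C (c : ℚ) : Phi (C c) = PowerSeries.C c := by
  rw [Phi, ← MvPolynomial.algebraMap_eq, AlgHom.commutes]; rfl

lemma Phi_D (f : Poly3) : Phi (Dop f) = Ram.theta (Phi f) := by
  induction f using MvPolynomial.induction_on with
  | C t => rw [Dop_C, map_zero, Phi_C, theta_C]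
  | add f g hf hg => rw [Dop_add, map_add, map_add, theta_add, hf, hg]
  | mul_X f i hf =>
    rw [Dop_mul, map_add, map_mul, map_mul, map_mul, theta_mul, hf]
    congr 2
    fin_cases i
    · simp only [Fin.zero_eta]
      rw [Dop_0, map_mul, map_sub, map_pow, Phi_0, Phi_1, Phi_C, Ram.ramanujan2,
        PowerSeries.smul_eq_C_mul]
    · simp only [Fin.mk_one]
      rw [Dop_1, map_mul, map_sub, map_mul, Phi_0, Phi_1, Phi_2, Phi_C, Ram.ramanujan4,
        PowerSeries.smul_eq_C_mul]
    · simp only [Fin.reduceFinMk]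
      rw [Dop_2, map_mul, map_sub, map_mul, map_pow, Phi_0, Phi_1, Phi_2, Phi_C, Ram.ramanujan6,
        PowerSeries.smul_eq_C_mul]

lemma Phi_it (n : ℕ) (f : Poly3) (i : ℕ) :
    PowerSeries.coeff i (Phi (Dop^[n] f)) = (i : ℚ) ^ n * PowerSeries.coeff i (Phi f) := by
  induction n with
  | zero => simp
  | succ n ih =>
    rw [Function.iterate_succ_apply', Phi_D, Ram.theta, PowerSeries.coeff_mk, ih, pow_succ]
    ring

/-- Eisenstein series with `ℤ_(p)` coefficients. -/
def eT (p : ℕ) [Fact p.Prime] (c : ℤ) (j : ℕ) : Lp p :=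
  PowerSeries.mk fun n => if n = 0 then 1 else (c : Tp p) * ∑ d ∈ n.divisors, (d : Tp p) ^ j

/-- The `q`-expansion map on `ℤ_(p)[P,Q,R]`. -/
def Ph : Rp p →+* Lp p :=
  MvPolynomial.eval₂Hom PowerSeries.C ![eT p (-24) 1, eT p 240 3, eT p (-504) 5]

/-- Inclusion of power series rings. -/
def il : Lp p →+* PowerSeries ℚ := PowerSeries.map (Tp p).subtype

lemma coeff_il (φ : Lp p) (n : ℕ) : PowerSeries.coeff n (il φ) = (PowerSeries.coeff n φ : Tp p) := by
  unfold il; rw [PowerSeries.coeff_map]; rfl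

lemma il_eT (c : ℤ) (j : ℕ) : il (eT p c j) =
    PowerSeries.mk fun n => if n = 0 then 1 else (c : ℚ) * sigmaQ j n := by
  ext n
  rw [coeff_il]
  simp only [eT, PowerSeries.coeff_mk, sigmaQ]
  split_ifs
  · simp
  · push_cast; rfl

lemma il_Ph (x : Rp p) : il (Ph x) = Phi (io x) := by
  have : (il.comp Ph : Rp p →+* _) = (Phi : Poly3 →+* PowerSeries ℚ).comp io := by
    apply MvPolynomial.ringHom_ext
    · intro t
      simp only [RingHom.comp_apply, io_C]
      rw [RingHom.coe_coe, Phi_C]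
      simp [Ph, il]
    · intro i
      simp only [RingHom.comp_apply, io_X]
      rw [RingHom.coe_coe]
      fin_cases i
      · simp only [Fin.zero_eta]
        rw [Phi_0]
        simp [Ph, il_eT, E2s]
      · simp only [Fin.mk_one]
        rw [Phi_1]
        simp [Ph, il_eT, E4s]
      · simp only [Fin.reduceFinMk]
        rw [Phi_2]
        simp [Ph, il_eT, E6s]
  exact RingHom.congr_fun this x

lemma coeff_Ph_it (hp5 : 5 ≤ p) (n : ℕ) (x : Rp p) (i : ℕ) :
    PowerSeries.coeff i (Ph ((Dp hp5)^[n] x)) = (i : Tp p) ^ n * PowerSeries.coeff i (Ph x) := by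
  apply Subtype.ext
  rw [← coeff_il, il_Ph, io_it, Phi_it, ← il_Ph, coeff_il]
  push_cast
  rfl

lemma th0 (hp5 : 5 ≤ p) {x : Rp p} {r : ℕ} (h : (p : Lp p) ^ r ∣ Ph x - 1) (n : ℕ) (hn : 1 ≤ n) :
    (p : Lp p) ^ r ∣ Ph ((Dp hp5)^[n] x) := by
  rw [pdvd] at h ⊢
  intro i
  rw [coeff_Ph_it]
  rcases Nat.eq_zero_or_pos i with rfl | hi
  · have : ((0 : ℕ) : Tp p) ^ n = 0 := by
      rw [Nat.cast_zero]; exact zero_pow (by omega)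
    rw [this, zero_mul]; exact dvd_zero _
  · have := h i
    rw [map_sub, PowerSeries.coeff_one, if_neg (by omega), sub_zero] at this
    exact this.mul_left _

lemma nat_cong1 (hp5 : 5 ≤ p) (i : ℕ) :
    ((p : ℤ) ^ 2) ∣ (i : ℤ) ^ (p ^ 2 - 1) - (i : ℤ) ^ (p - 1) := by
  have hp := hpF.out
  have hq : p ≤ p ^ 2 := by nlinarith
  by_cases h : p ∣ i
  · have h1 : (p : ℤ) ∣ i := Int.natCast_dvd_natCast.2 h
    apply dvd_sub
    · exact (pow_dvd_pow_of_dvd h1 2).trans (pow_dvd_pow _ (by omega))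
    · exact (pow_dvd_pow_of_dvd h1 2).trans (pow_dvd_pow _ (by omega))
  · have hc : Nat.Coprime i (p ^ 2) :=
      (Nat.Coprime.pow_left 2 ((hp.coprime_iff_not_dvd).2 h)).symm
    have h1 := Nat.ModEq.pow_totient hc
    rw [Nat.totient_prime_pow hp (by norm_num)] at h1
    have h2 := (Nat.modEq_iff_dvd.1 h1.symm).mul_left ((i : ℤ) ^ (p - 1))
    push_cast at h2
    have h3 : p - 1 + p ^ 1 * (p - 1) = p ^ 2 - 1 := by
      obtain ⟨q, rfl⟩ : ∃ q, p = q + 1 := ⟨p - 1, by omega⟩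
      simp only [Nat.add_sub_cancel]
      have : (q + 1) ^ 2 = q + (q + 1) ^ 1 * q + 1 := by ring
      omega
    rw [mul_sub, mul_one, ← pow_add, h3] at h2
    exact h2

lemma int_dvd_T {e : ℕ} {z : ℤ} (h : (p : ℤ) ^ e ∣ z) : (p : Tp p) ^ e ∣ (z : Tp p) := by
  obtain ⟨y, rfl⟩ := h
  exact ⟨y, by push_cast; rfl⟩

lemma th1 (hp5 : 5 ≤ p) {x : Rp p} {e : ℕ} (h : (p : Lp p) ^ e ∣ Ph (Dp hp5 x)) :
    (p : Lp p) ^ (e + 2) ∣ Ph ((Dp hp5)^[p ^ 2] x) - Ph ((Dp hp5)^[p] x) := by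
  have hp := hpF.out
  rw [pdvd] at h ⊢
  intro i
  have h1 := h i
  have h2 := coeff_Ph_it hp5 1 x i
  rw [Function.iterate_one, pow_one] at h2
  rw [h2] at h1
  rw [map_sub, coeff_Ph_it, coeff_Ph_it]
  have h3 := mul_dvd_mul h1 (int_dvd_T (nat_cong1 hp5 i))
  rw [pow_add]
  convert h3 using 1
  push_cast
  rw [← mul_pow_sub_one (pow_ne_zero 2 hp.ne_zero), ← mul_pow_sub_one hp.ne_zero]
  ring

lemma th2 (hp5 : 5 ≤ p) (x : Rp p) (n : ℕ) :
    (p : Lp p) ∣ Ph ((Dp hp5)^[p * n] x) - Ph ((Dp hp5)^[n] x) := by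
  have hp := hpF.out
  suffices h : (p : Lp p) ^ 1 ∣ Ph ((Dp hp5)^[p * n] x) - Ph ((Dp hp5)^[n] x) by simpa using h
  rw [pdvd]
  intro i
  rw [map_sub, coeff_Ph_it, coeff_Ph_it]
  have h1 : (p : ℤ) ∣ (i : ℤ) ^ (p * n) - (i : ℤ) ^ n := by
    rw [← ZMod.intCast_zmod_eq_zero_iff_dvd]
    push_cast
    rw [mul_comm, pow_mul, ZMod.pow_card, sub_self]
  have h2 := (int_dvd_T (e := 1) (by simpa using h1)).mul_right (PowerSeries.coeff i (Ph x))
  convert h2 using 1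
  push_cast
  ring

lemma hA (hp5 : 5 ≤ p) {A : Rp p} (h : Phi (io A) = EAs p) : (p : Lp p) ∣ Ph A - 1 := by
  suffices h : (p : Lp p) ^ 1 ∣ Ph A - 1 by simpa using h
  rw [pdvd]
  intro i
  rw [pow_one, map_sub, PowerSeries.coeff_one]
  have h1 := coeff_il (Ph A) i
  rw [il_Ph, h, EAs, PowerSeries.coeff_mk] at h1
  split_ifs at h1 ⊢ with hi
  · rw [show PowerSeries.coeff i (Ph A) = 1 from Subtype.ext h1.symm]
    simp
  · obtain ⟨t, ht, h2⟩ := eis_const (p := p) hp5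
    rw [h2] at h1
    refine ⟨-⟨t, ht⟩ * ∑ d ∈ i.divisors, (d : Tp p) ^ (p - 2), Subtype.ext ?_⟩
    rw [sub_zero, ← h1, sigmaQ]
    push_cast
    ring

end Inst

namespace Inst
variable {p : ℕ} [hpF : Fact p.Prime]

/-- Spanning set of modular polynomials of weight `w` (shifted by `s`). -/
def Mg (p : ℕ) [Fact p.Prime] (s w : ℕ) : AddSubgroup (Rp p) :=
  AddSubgroup.closure {f | ∃ (t : Tp p) (b c : ℕ), 4 * b + 6 * c + s = w ∧
    f = C t * (X 1 ^ b * X 2 ^ c)}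

/-- Modular polynomials of weight `w`. -/
def Mp (p : ℕ) [Fact p.Prime] (w : ℕ) : AddSubgroup (Rp p) := Mg p 0 w

lemma mem_Mg {s w b c : ℕ} (t : Tp p) (h : 4 * b + 6 * c + s = w) :
    C t * (X 1 ^ b * X 2 ^ c) ∈ Mg p s w :=
  AddSubgroup.subset_closure ⟨t, b, c, h, rfl⟩

lemma mem_Mp {w b c : ℕ} (t : Tp p) (h : 4 * b + 6 * c = w) :
    C t * (X 1 ^ b * X 2 ^ c) ∈ Mp p w := mem_Mg t (by omega)

lemma Mg_induction {s w : ℕ} {q : Rp p → Prop} (h0 : q 0)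
    (hadd : ∀ x y, q x → q y → q (x + y)) (hneg : ∀ x, q x → q (-x))
    (hg : ∀ (t : Tp p) b c, 4 * b + 6 * c + s = w → q (C t * (X 1 ^ b * X 2 ^ c)))
    {f : Rp p} (hf : f ∈ Mg p s w) : q f := by
  induction hf using AddSubgroup.closure_induction with
  | mem x hx => obtain ⟨t, b, c, h, rfl⟩ := hx; exact hg t b c h
  | zero => exact h0
  | add x y _ _ hx hy => exact hadd x y hx hy
  | neg x _ hx => exact hneg x hx

lemma Mp_induction {w : ℕ} {q : Rp p → Prop} (h0 : q 0)
    (hadd : ∀ x y, q x → q y → q (x + y)) (hneg : ∀ x, q x → q (-x))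
    (hg : ∀ (t : Tp p) b c, 4 * b + 6 * c = w → q (C t * (X 1 ^ b * X 2 ^ c)))
    {f : Rp p} (hf : f ∈ Mp p w) : q f :=
  Mg_induction h0 hadd hneg (fun t b c h => hg t b c (by omega)) hf

lemma C_mem (t : Tp p) : C t ∈ Mp p 0 := by
  have := mem_Mp (p := p) (w := 0) (b := 0) (c := 0) t rfl
  simpa using this
lemma one_mem' : (1 : Rp p) ∈ Mp p 0 := by simpa using C_mem (1 : Tp p)
lemma X1_mem : (X 1 : Rp p) ∈ Mp p 4 := by
  have := mem_Mp (p := p) (w := 4) (b := 1) (c := 0) 1 rfl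
  simpa using this
lemma X2_mem : (X 2 : Rp p) ∈ Mp p 6 := by
  have := mem_Mp (p := p) (w := 6) (b := 0) (c := 1) 1 rfl
  simpa using this

lemma mulM {v w : ℕ} {f g : Rp p} (hf : f ∈ Mp p v) (hg : g ∈ Mp p w) : f * g ∈ Mp p (v + w) := by
  refine Mp_induction (q := fun f => f * g ∈ Mp p (v + w)) ?_ ?_ ?_ ?_ hf
  · rw [zero_mul]; exact zero_mem _
  · intro x y hx hy; rw [add_mul]; exact add_mem hx hy
  · intro x hx; convert neg_mem hx using 1; ring
  · intro t b c h
    refine Mp_induction (q := fun g => C t * (X 1 ^ b * X 2 ^ c) * g ∈ Mp p (v + w)) ?_ ?_ ?_ ?_ hg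
    · rw [mul_zero]; exact zero_mem _
    · intro x y hx hy; rw [mul_add]; exact add_mem hx hy
    · intro x hx; convert neg_mem hx using 1; ring
    · intro t' b' c' h'
      have := mem_Mp (p := p) (b := b + b') (c := c + c') (w := v + w) (t * t') (by omega)
      convert this using 1
      rw [C_mul]
      ring

lemma serre (hp5 : 5 ≤ p) {w : ℕ} {f : Rp p} (hf : f ∈ Mp p w) :
    Dp hp5 f - (w : Rp p) * (C (u0 hp5) * X 0 * f) ∈ Mp p (w + 2) := by
  refine Mp_induction (q := fun f => Dp hp5 f - (w : Rp p) * (C (u0 hp5) * X 0 * f) ∈ Mp p (w + 2))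
    ?_ ?_ ?_ ?_ hf
  · simp
  · intro x y hx hy
    convert add_mem hx hy using 1
    rw [map_add]; ring
  · intro x hx
    convert neg_mem hx using 1
    rw [map_neg]; ring
  · intro t b c h
    have h1 : (C (t * u0 hp5) * (((b * 4 : ℕ) : Rp p) * (X 1 ^ (b - 1) * X 2 ^ (c + 1)))) ∈
        Mp p (w + 2) := by
      rcases Nat.eq_zero_or_pos b with rfl | hb
      · simp
      · have := mem_Mp (p := p) (b := b - 1) (c := c + 1) (w := w + 2)
          (t * u0 hp5 * ((b * 4 : ℕ) : Tp p)) (by omega)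
        rw [C_mul, map_natCast] at this
        rw [← mul_assoc]; exact this
    have h2 : (C (t * u0 hp5) * (((c * 6 : ℕ) : Rp p) * (X 1 ^ (b + 2) * X 2 ^ (c - 1)))) ∈
        Mp p (w + 2) := by
      rcases Nat.eq_zero_or_pos c with rfl | hb
      · simp
      · have := mem_Mp (p := p) (b := b + 2) (c := c - 1) (w := w + 2)
          (t * u0 hp5 * ((c * 6 : ℕ) : Tp p)) (by omega)
        rw [C_mul, map_natCast] at this
        rw [← mul_assoc]; exact this
    convert neg_mem (add_mem h1 h2) using 1
    rw [← h, Derivation.leibniz, Dp_C, Derivation.leibniz, Derivation.leibniz_pow,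
      Derivation.leibniz_pow, Dp_1, Dp_2, C_mul]
    simp only [smul_eq_mul, nsmul_eq_mul]
    rcases b with _ | b <;> rcases c with _ | c <;> (try simp only [Nat.add_sub_cancel]) <;> push_cast <;>
      ring

/-- The discriminant (up to normalisation). -/
def Dl (p : ℕ) [Fact p.Prime] : Rp p := X 1 ^ 3 - X 2 ^ 2

/-- The exponent of `R` in the distinguished monomial. -/
def c0 (w : ℕ) : ℕ := (w / 2) % 2
/-- The exponent of `Q` in the distinguished monomial. -/
def b0 (w : ℕ) : ℕ := (w - 6 * c0 w) / 4

lemma gen_form (w : ℕ) (t : Tp p) (c : ℕ) : ∀ b, 4 * b + 6 * c = w → ∃ f' ∈ Mg p 12 w,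
    C t * (X 1 ^ b * X 2 ^ c) = C t * (X 1 ^ b0 w * X 2 ^ c0 w) + Dl p * f' := by
  induction c using Nat.strong_induction_on with
  | _ c ih =>
    intro b h
    by_cases hc : c < 2
    · have h1 : c = c0 w := by unfold c0; omega
      have h2 : b = b0 w := by unfold b0; rw [← h1]; omega
      exact ⟨0, zero_mem _, by rw [mul_zero, add_zero, ← h1, ← h2]⟩
    · obtain ⟨f', hf', he⟩ := ih (c - 2) (by omega) (b + 3) (by omega)
      refine ⟨f' - C t * (X 1 ^ b * X 2 ^ (c - 2)), sub_mem hf' (mem_Mg t (by omega)), ?_⟩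
      rw [mul_sub, ← add_sub_assoc, ← he]
      obtain ⟨d, rfl⟩ := Nat.exists_eq_add_of_le' (show 2 ≤ c by omega)
      rw [Nat.add_sub_cancel]
      unfold Dl
      ring

lemma M_form {w : ℕ} {f : Rp p} (hf : f ∈ Mp p w) : ∃ (t : Tp p) (f' : Rp p), f' ∈ Mg p 12 w ∧
    f = C t * (X 1 ^ b0 w * X 2 ^ c0 w) + Dl p * f' := by
  refine Mp_induction (q := fun f => ∃ (t : Tp p) (f' : Rp p), f' ∈ Mg p 12 w ∧
    f = C t * (X 1 ^ b0 w * X 2 ^ c0 w) + Dl p * f') ?_ ?_ ?_ ?_ hf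
  · exact ⟨0, 0, zero_mem _, by simp⟩
  · rintro x y ⟨t, f, hf, rfl⟩ ⟨s, g, hg, rfl⟩
    exact ⟨t + s, f + g, add_mem hf hg, by rw [C_add]; ring⟩
  · rintro x ⟨t, f, hf, rfl⟩
    exact ⟨-t, -f, neg_mem hf, by rw [C_neg]; ring⟩
  · intro t b c h
    obtain ⟨f', h1, h2⟩ := gen_form w t c b h
    exact ⟨t, f', h1, h2⟩

lemma Mg_small {w : ℕ} (hw : w < 12) {f : Rp p} (hf : f ∈ Mg p 12 w) : f = 0 := by
  refine Mg_induction (q := fun f => f = 0) rfl ?_ ?_ ?_ hf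
  · rintro x y rfl rfl; simp
  · rintro x rfl; simp
  · intro t b c h; omega

lemma Mg_shift {w : ℕ} {f : Rp p} (hf : f ∈ Mg p 12 w) : f ∈ Mp p (w - 12) := by
  refine Mg_induction (q := fun f => f ∈ Mp p (w - 12)) (zero_mem _) ?_ ?_ ?_ hf
  · intro x y hx hy; exact add_mem hx hy
  · intro x hx; exact neg_mem hx
  · intro t b c h; exact mem_Mp t (by omega)

lemma Ph_C (t : Tp p) : Ph (C t : Rp p) = PowerSeries.C t := by simp [Ph]
lemma Ph_1 : Ph (X 1 : Rp p) = eT p 240 3 := by simp [Ph]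
lemma Ph_2 : Ph (X 2 : Rp p) = eT p (-504) 5 := by simp [Ph]

lemma cc_eT (c : ℤ) (j : ℕ) : PowerSeries.constantCoeff (eT p c j) = 1 := by
  rw [← PowerSeries.coeff_zero_eq_constantCoeff_apply, eT, PowerSeries.coeff_mk, if_pos rfl]

lemma c1_eT (c : ℤ) (j : ℕ) : PowerSeries.coeff 1 (eT p c j) = c := by
  rw [eT, PowerSeries.coeff_mk, if_neg (by norm_num)]
  simp

lemma eT_form (c : ℤ) (j : ℕ) : ∃ ψ : Lp p, eT p c j = 1 + PowerSeries.X * ψ ∧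
    PowerSeries.constantCoeff ψ = c := by
  have h : (PowerSeries.X : Lp p) ∣ eT p c j - 1 := by
    rw [PowerSeries.X_dvd_iff, map_sub, cc_eT]; simp
  obtain ⟨ψ, hψ⟩ := h
  refine ⟨ψ, by rw [← hψ]; ring, ?_⟩
  have h1 := c1_eT (p := p) c j
  rw [show eT p c j = 1 + ψ * PowerSeries.X by rw [mul_comm, ← hψ]; ring, map_add,
    show (1 : ℕ) = 0 + 1 by rfl, PowerSeries.coeff_succ_mul_X, PowerSeries.coeff_one] at h1
  simpa using h1

lemma Dl_form (hp5 : 5 ≤ p) : ∃ ψ : Lp p, Ph (Dl p) * ψ = PowerSeries.X := by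
  have hp := hpF.out
  obtain ⟨α, hα, hα0⟩ := eT_form (p := p) 240 3
  obtain ⟨β, hβ, hβ0⟩ := eT_form (p := p) (-504) 5
  let χ : Lp p := 3 * α + 3 * PowerSeries.X * α ^ 2 + PowerSeries.X ^ 2 * α ^ 3 - 2 * β -
    PowerSeries.X * β ^ 2
  have h1 : Ph (Dl p) = PowerSeries.X * χ := by
    unfold Dl
    rw [map_sub, map_pow, map_pow, Ph_1, Ph_2, hα, hβ]
    simp only [χ]
    ring
  have h2 : PowerSeries.constantCoeff χ = (1728 : Tp p) := by
    simp only [χ, map_sub, map_add, map_mul, map_pow, PowerSeries.constantCoeff_X, hα0, hβ0,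
      map_ofNat]
    push_cast
    ring
  have h3 : IsUnit (1728 : Tp p) := by
    have h4 : (1728 : Tp p) * u0 hp5 ^ 3 = 1 := by
      have := u0_spec (p := p) hp5
      calc (1728 : Tp p) * u0 hp5 ^ 3 = (12 * u0 hp5) ^ 3 := by ring
        _ = 1 := by rw [this, one_pow]
    exact IsUnit.of_mul_eq_one _ h4
  have h4 : IsUnit χ := by
    rw [PowerSeries.isUnit_iff_constantCoeff, h2]; exact h3
  obtain ⟨ψ, hψ⟩ := h4.exists_right_inv
  exact ⟨ψ, by rw [h1, mul_assoc, hψ, mul_one]⟩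

lemma inj (hp5 : 5 ≤ p) {r : ℕ} (w : ℕ) : ∀ {f : Rp p}, f ∈ Mp p w → (p : Lp p) ^ r ∣ Ph f →
    (p : Rp p) ^ r ∣ f := by
  induction w using Nat.strong_induction_on with
  | _ w ih =>
    intro f hf hd
    obtain ⟨t, f', hf', rfl⟩ := M_form hf
    obtain ⟨ψ, hψ⟩ := Dl_form (p := p) hp5
    have hDl0 : PowerSeries.constantCoeff (Ph (Dl p)) = 0 := by
      unfold Dl
      rw [map_sub, map_sub, map_pow, map_pow, map_pow, map_pow, Ph_1, Ph_2, cc_eT, cc_eT]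
      ring
    have ht : (p : Tp p) ^ r ∣ t := by
      have h0 := pdvd.1 hd 0
      rw [PowerSeries.coeff_zero_eq_constantCoeff_apply] at h0
      simp only [map_add, map_mul, map_pow, Ph_1, Ph_2, cc_eT, hDl0, Ph_C] at h0
      simpa using h0
    have htC : (p : Rp p) ^ r ∣ C t := by
      obtain ⟨s, rfl⟩ := ht
      exact ⟨C s, by rw [C_mul, C_pow, map_natCast]⟩
    have h1 : (p : Rp p) ^ r ∣ C t * (X 1 ^ b0 w * X 2 ^ c0 w) := htC.mul_right _
    apply dvd_add h1
    apply Dvd.dvd.mul_left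
    by_cases hw : w < 12
    · rw [Mg_small hw hf']; exact dvd_zero _
    · apply ih (w - 12) (by omega) (Mg_shift hf')
      have h2 : (p : Lp p) ^ r ∣ Ph (C t * (X 1 ^ b0 w * X 2 ^ c0 w)) := by
        have := map_dvd (Ph (p := p)) h1
        simpa using this
      rw [map_add] at hd
      have h3 := (dvd_add_right h2).1 hd
      rw [map_mul] at h3
      have h4 : (p : Lp p) ^ r ∣ Ph f' * PowerSeries.X := by
        rw [← hψ]
        have := h3.mul_right ψ
        convert this using 1
        ring
      rw [pdvd] at h4 ⊢
      intro n
      have := h4 (n + 1)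
      rwa [PowerSeries.coeff_succ_mul_X] at this

/-- Reduction `P ↦ 0`. -/
def prp : Rp p →+* Rp p := (MvPolynomial.aeval ![0, X 1, X 2] : Rp p →ₐ[Tp p] Rp p)

lemma prp_0 : prp (X 0 : Rp p) = 0 := by simp [prp]

lemma prp_M {w : ℕ} {f : Rp p} (hf : f ∈ Mp p w) : prp f = f := by
  refine Mp_induction (q := fun f => prp f = f) (map_zero _) ?_ ?_ ?_ hf
  · intro x y hx hy; rw [map_add, hx, hy]
  · intro x hx; rw [map_neg, hx]
  · intro t b c _
    simp [prp, MvPolynomial.algebraMap_eq]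

lemma cancel {A x : Rp p} (hA : (p : Lp p) ∣ Ph A - 1) (h : (p : Rp p) ∣ A * x) :
    (p : Rp p) ∣ x := by
  have hpr : Prime (p : Rp p) := by
    have := (MvPolynomial.prime_C_iff (Fin 3) (r := (p : Tp p))).2 p_prime
    simpa using this
  rcases hpr.dvd_or_dvd h with h1 | h1
  · exfalso
    have h2 := map_dvd (Ph (p := p)) h1
    rw [map_natCast] at h2
    have h3 := dvd_sub h2 hA
    rw [sub_sub_cancel] at h3
    have h4 : (p : Lp p) ^ 1 ∣ 1 := by simpa using h3
    have h5 := pdvd.1 h4 0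
    apply p_not_unit (p := p)
    apply isUnit_of_dvd_one
    simpa using h5
  · exact h1

lemma gen (S : Subring (Rp p)) (h0 : X 0 ∈ S) (hM : ∀ w f, f ∈ Mp p w → f ∈ S) (x : Rp p) :
    x ∈ S := by
  induction x using MvPolynomial.induction_on with
  | C t => exact hM 0 _ (C_mem t)
  | add f g hf hg => exact add_mem hf hg
  | mul_X f i hf =>
    refine mul_mem hf ?_
    fin_cases i
    · exact h0
    · exact hM 4 _ X1_mem
    · exact hM 6 _ X2_mem

lemma span_pow_form {R : Type*} [CommRing R] (a c : R) (n : ℕ) {x : R}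
    (hx : x ∈ Ideal.span {a, c} ^ n) :
    ∃ g : ℕ → R, x = ∑ i ∈ range (n + 1), c ^ (n - i) * a ^ i * g i := by
  induction n generalizing x with
  | zero => exact ⟨fun _ => x, by simp⟩
  | succ n ih =>
    rw [pow_succ] at hx
    induction hx using Submodule.mul_induction_on' with
    | mem_mul_mem y hy z hz =>
      obtain ⟨g, rfl⟩ := ih hy
      obtain ⟨s, t, rfl⟩ := Ideal.mem_span_pair.1 hz
      refine ⟨fun i => (if i ≤ n then t * g i else 0) + (if 1 ≤ i then s * g (i - 1) else 0), ?_⟩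
      have e1 : ∑ i ∈ range (n + 1 + 1), c ^ (n + 1 - i) * a ^ i * (if i ≤ n then t * g i else 0) =
          (∑ i ∈ range (n + 1), c ^ (n - i) * a ^ i * g i) * (t * c) := by
        rw [Finset.sum_range_succ, if_neg (by omega), mul_zero, add_zero, Finset.sum_mul]
        apply Finset.sum_congr rfl
        intro i hi
        have hi := Finset.mem_range.1 hi
        rw [if_pos (by omega), show n + 1 - i = (n - i) + 1 by omega, pow_succ]
        ring
      have e2 : ∑ i ∈ range (n + 1 + 1), c ^ (n + 1 - i) * a ^ i *
          (if 1 ≤ i then s * g (i - 1) else 0) =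
          (∑ i ∈ range (n + 1), c ^ (n - i) * a ^ i * g i) * (s * a) := by
        rw [Finset.sum_range_succ', if_neg (by omega), mul_zero, add_zero, Finset.sum_mul]
        apply Finset.sum_congr rfl
        intro i _
        rw [if_pos (by omega), show n + 1 - (i + 1) = n - i by omega, pow_succ, Nat.add_sub_cancel]
        ring
      simp only [mul_add, Finset.sum_add_distrib, e1, e2]
      ring
    | add y _ z _ hy hz =>
      obtain ⟨g, rfl⟩ := hy
      obtain ⟨g', rfl⟩ := hz
      refine ⟨fun i => g i + g' i, ?_⟩
      rw [← Finset.sum_add_distrib]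
      apply Finset.sum_congr rfl
      intro i _
      ring

/-- The grading homomorphism. -/
def sg : Rp p →+* Polynomial (Rp p) :=
  MvPolynomial.eval₂Hom (Polynomial.C.comp C)
    ![0, Polynomial.C (X 1) * Polynomial.X ^ 4, Polynomial.C (X 2) * Polynomial.X ^ 6]

lemma sg_C (t : Tp p) : sg (C t : Rp p) = Polynomial.C (C t) := by simp [sg]
lemma sg_0 : sg (X 0 : Rp p) = 0 := by simp [sg]
lemma sg_1 : sg (X 1 : Rp p) = Polynomial.C (X 1) * Polynomial.X ^ 4 := by simp [sg]
lemma sg_2 : sg (X 2 : Rp p) = Polynomial.C (X 2) * Polynomial.X ^ 6 := by simp [sg]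

lemma sg_M {w : ℕ} {f : Rp p} (hf : f ∈ Mp p w) : sg f = Polynomial.C f * Polynomial.X ^ w := by
  refine Mp_induction (q := fun f => sg f = Polynomial.C f * Polynomial.X ^ w) ?_ ?_ ?_ ?_ hf
  · simp
  · intro x y hx hy; rw [map_add, hx, hy, map_add]; ring
  · intro x hx; rw [map_neg, hx, map_neg]; ring
  · intro t b c h
    simp only [map_mul, map_pow, sg_C, sg_1, sg_2]
    rw [← h]
    ring

lemma coeff_sg (h : Rp p) : ∀ v, (sg h).coeff v ∈ Mp p v := by
  have key : ∀ (f : Rp p) (d : ℕ) (m : Rp p), m ∈ Mp p d → (∀ v, (sg f).coeff v ∈ Mp p v) →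
      ∀ v, (sg f * (Polynomial.C m * Polynomial.X ^ d)).coeff v ∈ Mp p v := by
    intro f d m hm hf v
    rw [← mul_assoc, Polynomial.coeff_mul_X_pow']
    split_ifs with hv
    · rw [Polynomial.coeff_mul_C]
      have := mulM (hf (v - d)) hm
      rwa [Nat.sub_add_cancel hv] at this
    · exact zero_mem _
  induction h using MvPolynomial.induction_on with
  | C t =>
    intro v
    rw [sg_C, Polynomial.coeff_C]
    split_ifs with hv
    · rw [hv]; exact C_mem t
    · exact zero_mem _
  | add f g hf hg => intro v; rw [map_add, Polynomial.coeff_add]; exact add_mem (hf v) (hg v)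
  | mul_X f i hf =>
    intro v
    rw [map_mul]
    fin_cases i
    · simp only [Fin.zero_eta]
      rw [sg_0, mul_zero, Polynomial.coeff_zero]; exact zero_mem _
    · simp only [Fin.mk_one]
      rw [sg_1]; exact key f 4 _ X1_mem hf v
    · simp only [Fin.reduceFinMk]
      rw [sg_2]; exact key f 6 _ X2_mem hf v

lemma powM {w : ℕ} {f : Rp p} (n : ℕ) (h : f ∈ Mp p w) : f ^ n ∈ Mp p (n * w) := by
  induction n with
  | zero => simpa using one_mem'
  | succ n ih => rw [pow_succ, add_mul, one_mul]; exact mulM ih h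

lemma decomp {A : Rp p} (hA : A ∈ Mp p (p - 1)) {w n : ℕ} {f : Rp p} (hf : f ∈ Mp p w)
    (hI : f ∈ Ideal.span {A ^ p, (p : Rp p)} ^ n) : ∃ g : ℕ → Rp p,
    (∀ i, ∃ w', w' ≡ w [MOD p] ∧ g i ∈ Mp p w') ∧
      f = ∑ i ∈ range (n + 1), (p : Rp p) ^ (n - i) * A ^ (p * i) * g i := by
  obtain ⟨h, hh⟩ := span_pow_form _ _ n hI
  refine ⟨fun i => if p * i * (p - 1) ≤ w then (sg (h i)).coeff (w - p * i * (p - 1)) else 0,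
    ?_, ?_⟩
  · intro i
    simp only
    split_ifs with hi
    · refine ⟨_, ?_, coeff_sg _ _⟩
      rw [Nat.modEq_iff_dvd, Nat.cast_sub hi]
      refine ⟨((i * (p - 1) : ℕ) : ℤ), ?_⟩
      rw [mul_assoc, Nat.cast_mul p]
      ring
    · exact ⟨w, rfl, zero_mem _⟩
  · have h1 : (sg f).coeff w = f := by rw [sg_M hf]; simp
    rw [← h1]
    conv_lhs => rw [hh]
    rw [map_sum, Polynomial.finsetSum_coeff]
    apply Finset.sum_congr rfl
    intro i _
    rw [map_mul, map_mul, map_pow, map_natCast, ← pow_mul, sg_M (powM (p * i) hA)]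
    have h2 : (p : Polynomial (Rp p)) ^ (n - i) * (Polynomial.C (A ^ (p * i)) *
        Polynomial.X ^ (p * i * (p - 1))) * sg (h i) =
        Polynomial.C ((p : Rp p) ^ (n - i) * A ^ (p * i)) * (sg (h i) *
          Polynomial.X ^ (p * i * (p - 1))) := by
      rw [map_mul, map_pow Polynomial.C (p : Rp p), map_natCast]; ring
    rw [h2, Polynomial.coeff_C_mul, Polynomial.coeff_mul_X_pow']

/-- The concrete instance of the abstract data. -/
def theSetup (hp5 : 5 ≤ p) (A : Rp p) (hAM : A ∈ Mp p (p - 1)) (hAP : Phi (io A) = EAs p) :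
    Abs.Setup p (Rp p) (Lp p) where
  D := Dp hp5
  P := X 0
  Q := X 1
  u := C (u0 hp5)
  A := A
  M := Mp p
  pr := prp
  Φ := Ph
  hp := hpF.out
  hp5 := hp5
  hu := by
    rw [show (12 : Rp p) = C 12 from (map_ofNat C 12).symm, ← C_mul, u0_spec, C_1]
  uM := C_mem _
  QM := X1_mem
  oneM := one_mem'
  AM := hAM
  mulM := mulM
  hP := Dp_0 hp5
  serre := serre hp5
  prP := prp_0
  prM := prp_M
  inj := fun hf h => inj hp5 _ hf h
  hA := hA hp5 hAP
  th0 := fun h n hn => th0 hp5 h n hn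
  th1 := fun h => th1 hp5 h
  th2 := th2 hp5
  cancel := fun h => cancel (hA hp5 hAP) h
  gen := gen
  decomp := fun hf h => decomp hAM hf h

lemma mem_of_iso {w : ℕ} {x : Rp p} (h1 : Isobaric w (io x)) (h2 : NoP (io x)) : x ∈ Mp p w := by
  rw [x.as_sum]
  apply AddSubgroup.sum_mem
  intro m hm
  have hm' : m ∈ (io x).support := by
    rw [mem_support_iff, coeff_io]
    rw [mem_support_iff] at hm
    intro h
    exact hm (Subtype.ext h)
  have h3 := h1 m hm'
  have h4 := h2 m hm'
  have h5 := mem_Mp (p := p) (w := w) (b := m 1) (c := m 2) (coeff m x) (by omega)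
  convert h5 using 1
  rw [monomial_eq]
  congr 1
  rw [Finsupp.prod_fintype _ _ (by simp), Fin.prod_univ_three, h4]
  simp

lemma inIdealPow {A x : Rp p} {n : ℕ} (h : x ∈ Ideal.span {A ^ p, (p : Rp p)} ^ n) :
    InIdealPow p (io A) n (io x) := by
  obtain ⟨g, hg⟩ := span_pow_form _ _ n h
  refine ⟨fun i => io (g i), fun i => io_pInt _, ?_⟩
  conv_lhs => rw [hg]
  rw [map_sum]
  apply Finset.sum_congr rfl
  intro i _
  rw [map_mul, map_mul, map_pow, map_pow, map_pow, map_natCast, pow_mul]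

end Inst

theorem stmt_19 (p : ℕ) (hp : p.Prime) (hp5 : 5 ≤ p)
    (A : Poly3) (hAiso : Isobaric (p - 1) A) (hAnoP : NoP A)
    (hAint : polyPInt p A) (hAPhi : Phi A = EAs p)
    (k : ℕ) (hk : 0 < k) (F : Poly3) (hFiso : Isobaric k F) (hFnoP : NoP F)
    (hFint : polyPInt p F) (hpk : 2 * k - 2 ≤ p)
    (m : ℕ) (hm1 : 1 ≤ 2 * m) (hm2 : 2 * m ≤ k - 2) :
    InIdealPow p A (2 * m - 1) (Dop^[m * p ^ 2 - p] F) ∧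
      InIdealPow p A (2 * m) (Dop^[m * p ^ 2] F) := by
  haveI : Fact p.Prime := ⟨hp⟩
  obtain ⟨a, rfl⟩ := Inst.exists_io hAint
  obtain ⟨f, rfl⟩ := Inst.exists_io hFint
  have haM := Inst.mem_of_iso hAiso hAnoP
  have hfM := Inst.mem_of_iso hFiso hFnoP
  obtain ⟨h0, h1, -⟩ := (Inst.theSetup hp5 a haM hAPhi).main (F := f) hfM hk hpk m hm2
  have h1 := h1 (by omega)
  rw [← Inst.io_it hp5, ← Inst.io_it hp5]
  exact ⟨Inst.inIdealPow h1, Inst.inIdealPow h0⟩
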